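/- Let r ≥ 2 and a = (α_1,…,α_r) ∈ (0,2)^r. For each i let p_i(m) = c_i(1+|m|)^{−1−α_i} on ℤ, with c_i > 0 the normalizing constant making p_i a probability measure on ℤ. Let μ_a be the probability measure on the free metabelian group S_{2,r} = F_r/[[F_r,F_r],[F_r,F_r]] given by μ_a(g) = (1/r)·Σ_{i=1}^r Σ_{m∈ℤ} p_i(m)·1{g = s_i^m} (where s_i denotes the image of the i-th free generator). Set 1/α = (1/r)(1/α_1 + … + 1/α_r). Then there exists a constant C ≥ 1 such that for all sufficiently large n: exp(−C·n^{r/(r+α)}·(log n)^{α/(r+α)}) ≤ μ_a^{(n)}(e) ≤ exp(−(1/C)·n^{r/(r+α)}·(log n)^{α/(r+α)}). -/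

import Mathlib

open scoped Pointwise

noncomputable section

open Classical in
/-- Convolution of two real-valued functions ("measures") on a group:
`(μ ∗ ν)(g) = Σ_h μ(h) ν(h⁻¹ g)`. -/
noncomputable def conv {G : Type*} [Group G] (μ ν : G → ℝ) : G → ℝ :=
  fun g => ∑' h : G, μ h * ν (h⁻¹ * g)

open Classical in
/-- `convPow μ n` is the `n`-fold convolution power of `μ`;
`convPow μ 0` is the Dirac mass at the identity. -/
noncomputable def convPow {G : Type*} [Group G] (μ : G → ℝ) : ℕ → G → ℝ
  | 0 => fun g => if g = 1 then 1 else 0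
  | n + 1 => conv μ (convPow μ n)

/-- Pushforward of a measure along a map. -/
noncomputable def pushforward {G H : Type*} (f : G → H) (μ : G → ℝ) : H → ℝ :=
  fun h => ∑' g : {g : G // f g = h}, μ g.1

open Classical in
/-- The lazy simple random walk measure on the free group on `r` generators:
mass `1/2` at the identity and mass `1/(4r)` at each `sᵢ^{±1}`. -/
noncomputable def lazySRW (r : ℕ) : FreeGroup (Fin r) → ℝ := fun g =>
  if g = 1 then 1 / 2
  else if ∃ i : Fin r, g = FreeGroup.of i ∨ g = (FreeGroup.of i)⁻¹ then 1 / (4 * r)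
  else 0

/-- The lazy simple random walk measure on the quotient `F_r / M`, i.e. the pushforward
of `lazySRW r` under the quotient map. -/
noncomputable def lazySRWQuot (r : ℕ) (M : Subgroup (FreeGroup (Fin r))) [M.Normal] :
    FreeGroup (Fin r) ⧸ M → ℝ :=
  pushforward (QuotientGroup.mk : FreeGroup (Fin r) → FreeGroup (Fin r) ⧸ M) (lazySRW r)

/-- Iterated logarithms: `iterLog 1 x = log (1 + x)` and
`iterLog (i+1) x = log (1 + iterLog i x)`. -/
noncomputable def iterLog : ℕ → ℝ → ℝ
  | 0, x => x
  | n + 1, x => Real.log (1 + iterLog n x)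

instance derivedSeriesNormal (G : Type*) [Group G] (n : ℕ) : (derivedSeries G n).Normal :=
  derivedSeries_normal G n

open scoped Classical

open scoped ENNReal

/-! ## Part A: kernels -/

/-- The law of the product of `n` independent random steps `v ω`, `ω` of weight `w ω`. -/
def KK {Ω G : Type*} [Group G] (w : Ω → ℝ≥0∞) (v : Ω → G) : ℕ → G → ℝ≥0∞
  | 0 => fun g => if g = 1 then 1 else 0
  | n + 1 => fun g => ∑' ω, w ω * KK w v n ((v ω)⁻¹ * g)

section KK
variable {Ω G : Type*} [Group G] (w : Ω → ℝ≥0∞) (v : Ω → G)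

theorem KK_le_one (hw : ∑' ω, w ω = 1) (n : ℕ) (g : G) : KK w v n g ≤ 1 := by
  induction n generalizing g with
  | zero => simp only [KK]; split_ifs <;> simp
  | succ n ih =>
    calc KK w v (n+1) g ≤ ∑' ω, w ω * 1 := ENNReal.tsum_le_tsum fun ω => by gcongr; exact ih _
      _ = 1 := by simpa using hw

theorem KK_sup (hw : ∑' ω, w ω = 1) (m : ℕ) (B : ℝ≥0∞) (hB : ∀ g, KK w v m g ≤ B) (n : ℕ) (g : G) :
    KK w v (m + n) g ≤ B := by
  induction n generalizing g with
  | zero => exact hB g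
  | succ n ih =>
    calc KK w v (m + n+1) g ≤ ∑' ω, w ω * B := ENNReal.tsum_le_tsum fun ω => by gcongr; exact ih _
      _ = B := by rw [ENNReal.tsum_mul_right, hw, one_mul]

theorem KK_add (m n : ℕ) (g : G) : KK w v (m + n) g = ∑' h, KK w v m h * KK w v n (h⁻¹ * g) := by
  induction m generalizing g with
  | zero =>
    rw [tsum_eq_single 1]
    · simp [KK]
    · intro h hh; simp [KK, hh]
  | succ m ih =>
    rw [show m + 1 + n = (m + n) + 1 by ring]
    simp only [KK]
    simp_rw [ih, ← ENNReal.tsum_mul_right, ← ENNReal.tsum_mul_left]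
    rw [ENNReal.tsum_comm (α := G)]
    refine tsum_congr fun ω => ?_
    rw [← (Equiv.mulLeft (v ω)⁻¹).tsum_eq]
    refine tsum_congr fun h => ?_
    simp [mul_assoc]

theorem KK_right (n : ℕ) (g : G) : KK w v (n+1) g = ∑' ω, w ω * KK w v n (g * (v ω)⁻¹) := by
  induction n generalizing g with
  | zero =>
    simp only [KK]
    refine tsum_congr fun ω => ?_
    congr 2
    simp only [eq_iff_iff]
    constructor <;> intro h
    · rw [inv_mul_eq_one] at h; simp [h]
    · rw [mul_inv_eq_one] at h; simp [h]
  | succ n ih =>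
    calc KK w v (n+1+1) g = ∑' ω, w ω * KK w v (n+1) ((v ω)⁻¹ * g) := rfl
      _ = ∑' ω, w ω * ∑' ω', w ω' * KK w v n ((v ω)⁻¹ * g * (v ω')⁻¹) := by simp_rw [ih]
      _ = ∑' ω', w ω' * ∑' ω, w ω * KK w v n ((v ω)⁻¹ * (g * (v ω')⁻¹)) := by
        simp_rw [← ENNReal.tsum_mul_left]
        rw [ENNReal.tsum_comm]
        refine tsum_congr fun a => tsum_congr fun b => ?_
        rw [mul_assoc (v b)⁻¹]; ring
      _ = _ := rfl

theorem KK_inv (σ : Ω ≃ Ω) (hσw : ∀ ω, w (σ ω) = w ω) (hσv : ∀ ω, v (σ ω) = (v ω)⁻¹) (n : ℕ) (g : G) :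
    KK w v n g⁻¹ = KK w v n g := by
  induction n generalizing g with
  | zero => simp [KK]
  | succ n ih =>
    rw [KK_right]
    simp only [KK]
    rw [← σ.tsum_eq]
    refine tsum_congr fun ω => ?_
    rw [hσw, hσv, ← ih]; simp

theorem KK_map {H : Type*} [Group H] (φ : G →* H) (n : ℕ) (g : G) :
    KK w v n g ≤ KK w (fun ω => φ (v ω)) n (φ g) := by
  induction n generalizing g with
  | zero =>
    simp only [KK]
    split_ifs with h1 h2 <;> simp_all
  | succ n ih =>
    simp only [KK]
    refine ENNReal.tsum_le_tsum fun ω => ?_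
    gcongr
    simpa using ih ((v ω)⁻¹ * g)

/-- two steps at once -/
theorem KK_two (n : ℕ) (g : G) :
    KK w v (2 * n) g = KK (fun p : Ω × Ω => w p.1 * w p.2) (fun p => v p.1 * v p.2) n g := by
  induction n generalizing g with
  | zero => simp [KK]
  | succ n ih =>
    rw [show 2 * (n+1) = 2 * n + 1 + 1 by ring]
    simp only [KK]
    rw [ENNReal.tsum_prod']
    simp_rw [ih, ← ENNReal.tsum_mul_left]
    refine tsum_congr fun a => tsum_congr fun b => ?_
    simp [mul_assoc]

theorem KK_convPow (hw : ∑' ω, w ω = 1) (μ : G → ℝ)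
    (hμ : ∀ g, μ g = (∑' ω, if g = v ω then w ω else 0).toReal) (n : ℕ) (g : G) :
    convPow μ n g = (KK w v n g).toReal := by
  induction n generalizing g with
  | zero => simp only [KK, convPow]; split_ifs <;> simp
  | succ n ih =>
    simp only [KK, convPow, conv]
    have h1 : ∀ h : G, μ h * convPow μ n (h⁻¹ * g)
        = ((∑' ω, if h = v ω then w ω else 0) * KK w v n (h⁻¹ * g)).toReal := by
      intro h; rw [hμ, ih, ENNReal.toReal_mul]
    simp_rw [h1]
    rw [← ENNReal.tsum_toReal_eq]
    · congr 1
      simp_rw [← ENNReal.tsum_mul_right]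
      rw [ENNReal.tsum_comm]
      refine tsum_congr fun ω => ?_
      rw [tsum_eq_single (v ω)]
      · simp
      · intro h hh; simp [hh]
    · intro h
      apply ENNReal.mul_ne_top
      · apply ne_of_lt
        calc (∑' ω, if h = v ω then w ω else 0) ≤ ∑' ω, w ω :=
              ENNReal.tsum_le_tsum fun ω => by split_ifs <;> simp
          _ < ⊤ := by simp [hw]
      · exact ne_of_lt ((KK_le_one w v hw _ _).trans_lt (by simp))

end KK

/-! ## Part B: lower bound, group part -/

section Lower
variable {r : ℕ} {G : Type*} [Group G] (s : Fin r → G)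

/-- unit vector -/
def ev {r : ℕ} (i : Fin r) (m : ℤ) : Fin r → ℤ := Pi.single i m

theorem ev_add {r : ℕ} (i : Fin r) (m k : ℤ) : ev i (m + k) = ev i m + ev i k := by
  simp [ev, Pi.single_add]

/-- section of the projection to `ℤ^r`. -/
def tauS (x : Fin r → ℤ) : G := (List.ofFn fun i => s i ^ x i).prod

theorem tauS_zero : tauS s 0 = 1 := by
  simp [tauS, List.ofFn_const]

theorem tauS_ab (x : Fin r → ℤ) :
    Abelianization.of (tauS s x) = ∏ i, (Abelianization.of (s i)) ^ x i := by
  rw [tauS, map_list_prod, List.map_ofFn, List.prod_ofFn]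
  simp

theorem edge_mem (x : Fin r → ℤ) (i : Fin r) :
    tauS s x * s i * (tauS s (x + ev i 1))⁻¹ ∈ commutator G := by
  rw [← Abelianization.ker_of, MonoidHom.mem_ker]
  simp only [map_mul, map_inv, tauS_ab]
  rw [mul_inv_eq_one]
  simp only [Pi.add_apply, zpow_add, Finset.prod_mul_distrib]
  congr 1
  rw [Finset.prod_eq_single i]
  · simp [ev]
  · intro j _ hj; simp [ev, hj]
  · simp

/-- edges as elements of the derived subgroup -/
def edgeE (x : Fin r → ℤ) (i : Fin r) : commutator G := ⟨_, edge_mem s x i⟩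

/-- survival probability in `B` -/
def surv {Ω : Type*} (w : Ω → ℝ≥0∞) (d : Ω → (Fin r → ℤ)) (B : Finset (Fin r → ℤ)) :
    ℕ → (Fin r → ℤ) → ℝ≥0∞
  | 0 => fun x => if x ∈ B then 1 else 0
  | n + 1 => fun x => if x ∈ B then ∑' ω, w ω * surv w d B n (x + d ω) else 0

theorem surv_ge {Ω : Type*} (w : Ω → ℝ≥0∞) (d : Ω → (Fin r → ℤ)) (B : Finset (Fin r → ℤ))
    (u : (Fin r → ℤ) → ℝ≥0∞) (lam : ℝ≥0∞) (hu : ∀ x, u x ≤ 1) (hB : ∀ x, x ∉ B → u x = 0)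
    (hP : ∀ x, lam * u x ≤ ∑' ω, w ω * u (x + d ω)) (n : ℕ) (x) :
    lam ^ n * u x ≤ surv w d B n x := by
  induction n generalizing x with
  | zero =>
    simp only [surv]; split_ifs with h
    · simpa using hu x
    · simp [hB x h]
  | succ n ih =>
    simp only [surv]; split_ifs with h
    · calc lam ^ (n+1) * u x = lam ^ n * (lam * u x) := by ring
        _ ≤ lam ^ n * ∑' ω, w ω * u (x + d ω) := by gcongr; exact hP x
        _ = ∑' ω, w ω * (lam ^ n * u (x + d ω)) := by
            rw [← ENNReal.tsum_mul_left]; exact tsum_congr fun ω => by ring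
        _ ≤ _ := ENNReal.tsum_le_tsum fun ω => by gcongr; exact ih _
    · simp [hB x h]

/-- commutative group structure on derived subgroup of a metabelian group -/
@[reducible] def commG (hc : ∀ a b : commutator G, a * b = b * a) : CommGroup (commutator G) :=
  { (inferInstance : Group (commutator G)) with mul_comm := hc }

/-- product of edges with multiplicities -/
def flowE (hc : ∀ a b : commutator G, a * b = b * a) (B : Finset (Fin r → ℤ))
    (k : ({x // x ∈ B} × Fin r) → ℤ) : commutator G :=
  letI := commG hc
  ∏ p, (edgeE s p.1.1 p.2) ^ k p

theorem flowE_add (hc : ∀ a b : commutator G, a * b = b * a) (B : Finset (Fin r → ℤ)) (k l) :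
    flowE s hc B (k + l) = flowE s hc B k * flowE s hc B l := by
  let _ := commG hc
  simp only [flowE, Pi.add_apply, zpow_add]
  exact Finset.prod_mul_distrib

theorem flowE_zero (hc : ∀ a b : commutator G, a * b = b * a) (B : Finset (Fin r → ℤ)) :
    flowE s hc B 0 = 1 := by
  let _ := commG hc
  simp only [flowE, Pi.zero_apply, zpow_zero]
  exact Finset.prod_const_one

theorem flowE_neg (hc : ∀ a b : commutator G, a * b = b * a) (B : Finset (Fin r → ℤ)) (k) :
    flowE s hc B (-k) = (flowE s hc B k)⁻¹ := by
  rw [eq_inv_iff_mul_eq_one, ← flowE_add, neg_add_cancel, flowE_zero]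

theorem flowE_single (hc : ∀ a b : commutator G, a * b = b * a) (B : Finset (Fin r → ℤ)) (p) :
    flowE s hc B (Pi.single p 1) = edgeE s p.1.1 p.2 := by
  let _ := commG hc
  simp only [flowE]
  refine (Finset.prod_eq_single p ?_ ?_).trans ?_
  · intro q _ hq; rw [Pi.single_eq_of_ne hq, zpow_zero]
  · simp
  · simp

theorem step_pos (hc : ∀ a b : commutator G, a * b = b * a) (B : Finset (Fin r → ℤ))
    (x : Fin r → ℤ) (i : Fin r) (m : ℕ) (hB : ∀ j : ℕ, j ≤ m → x + ev i j ∈ B) :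
    ∃ k : ({x // x ∈ B} × Fin r) → ℤ, (∀ p, 0 ≤ k p ∧ k p ≤ 1) ∧
      (∀ p, x i + m ≤ p.1.1 i → k p = 0) ∧
      tauS s x * s i ^ m = flowE s hc B k * tauS s (x + ev i m) := by
  induction m with
  | zero =>
    refine ⟨0, by simp, by simp, ?_⟩
    simp [flowE_zero, ev]
  | succ m ih =>
    obtain ⟨k, h1, h2, h3⟩ := ih fun j hj => hB j (by omega)
    set p : {x // x ∈ B} × Fin r := (⟨x + ev i m, hB m (by omega)⟩, i) with hp
    have hpi : p.1.1 i = x i + m := by simp [hp, ev]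
    refine ⟨k + Pi.single p 1, ?_, ?_, ?_⟩
    · intro q
      by_cases hq : q = p
      · rw [hq]; simp [h2 p hpi.ge]
      · simp [hq, h1 q]
    · intro q hq
      have : q ≠ p := by rintro rfl; rw [hpi] at hq; push_cast at hq; omega
      simp only [Pi.add_apply, Pi.single_eq_of_ne this, add_zero]
      apply h2; push_cast at hq; omega
    · rw [flowE_add, flowE_single, pow_succ, ← mul_assoc, h3]
      simp only [edgeE, hp, Subgroup.coe_mul, mul_assoc]
      push_cast
      rw [ev_add, ← add_assoc]
      simp

theorem step_any (hc : ∀ a b : commutator G, a * b = b * a) (B : Finset (Fin r → ℤ))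
    (hconv : ∀ x i, ∀ m : ℕ, x ∈ B → x + ev i (m : ℤ) ∈ B → ∀ j : ℕ, j ≤ m → x + ev i (j : ℤ) ∈ B)
    (x : Fin r → ℤ) (i : Fin r) (m : ℤ) (hx : x ∈ B) (hx' : x + ev i m ∈ B) :
    ∃ k : ({x // x ∈ B} × Fin r) → ℤ, (∀ p, -1 ≤ k p ∧ k p ≤ 1) ∧
      tauS s x * s i ^ m = flowE s hc B k * tauS s (x + ev i m) := by
  obtain ⟨m, rfl | rfl⟩ := m.eq_nat_or_neg
  · obtain ⟨k, h1, -, h3⟩ := step_pos s hc B x i m (hconv x i m hx hx')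
    exact ⟨k, fun p => ⟨by linarith [(h1 p).1], (h1 p).2⟩, by simpa using h3⟩
  · have h0 : x + ev i (-(m:ℤ)) + ev i (m : ℤ) = x := by
      rw [add_assoc, ← ev_add]; simp [ev]
    obtain ⟨k, h1, -, h3⟩ := step_pos s hc B (x + ev i (-(m:ℤ))) i m
      (hconv _ i m hx' (by rw [h0]; exact hx))
    rw [h0] at h3
    refine ⟨-k, fun p => ⟨by simpa using (h1 p).2, ?_⟩, ?_⟩
    · have := (h1 p).1; simp only [Pi.neg_apply]; omega
    · rw [flowE_neg, Subgroup.coe_inv, eq_inv_mul_iff_mul_eq, ← mul_assoc, ← h3]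
      simp

/-- The set of elements reached. -/
def AA (hc : ∀ a b : commutator G, a * b = b * a) (B : Finset (Fin r → ℤ)) (n : ℕ) : Finset G :=
  ((Fintype.piFinset fun _ : {x // x ∈ B} × Fin r => Finset.Icc (-(n:ℤ)) n) ×ˢ B).image
    fun q => (flowE s hc B q.1 : G) * tauS s q.2

theorem AA_card (hc : ∀ a b : commutator G, a * b = b * a) (B : Finset (Fin r → ℤ)) (n : ℕ) :
    (AA s hc B n).card ≤ (2 * n + 1) ^ (B.card * r) * B.card := by
  refine Finset.card_image_le.trans ?_
  rw [Finset.card_product, Fintype.card_piFinset]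
  simp only [Int.card_Icc, Finset.prod_const, Finset.card_univ, Fintype.card_prod,
    Fintype.card_coe, Fintype.card_fin]
  rw [show ((n:ℤ) + 1 - -(n:ℤ)).toNat = 2 * n + 1 by omega]

theorem AA_mul (hc : ∀ a b : commutator G, a * b = b * a) (B : Finset (Fin r → ℤ)) (n : ℕ)
    (k : ({x // x ∈ B} × Fin r) → ℤ) (hk : ∀ p, -1 ≤ k p ∧ k p ≤ 1) (g : G)
    (hg : g ∈ AA s hc B n) : (flowE s hc B k : G) * g ∈ AA s hc B (n+1) := by
  simp only [AA, Finset.mem_image, Finset.mem_product, Fintype.mem_piFinset, Finset.mem_Icc,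
    Prod.exists] at hg ⊢
  obtain ⟨l, y, ⟨hl, hy⟩, rfl⟩ := hg
  refine ⟨k + l, y, ⟨fun p => ?_, hy⟩, ?_⟩
  · have := hk p; have := hl p; simp only [Pi.add_apply]; push_cast; omega
  · rw [flowE_add, Subgroup.coe_mul, mul_assoc]

theorem surv_le (hc : ∀ a b : commutator G, a * b = b * a) (B : Finset (Fin r → ℤ))
    (hconv : ∀ x i, ∀ m : ℕ, x ∈ B → x + ev i (m : ℤ) ∈ B → ∀ j : ℕ, j ≤ m → x + ev i (j : ℤ) ∈ B)
    (w : Fin r × ℤ → ℝ≥0∞) (n : ℕ) (x : Fin r → ℤ) (hx : x ∈ B) :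
    surv w (fun p => ev p.1 p.2) B n x ≤
      ∑' g, KK w (fun p => s p.1 ^ p.2) n g * if tauS s x * g ∈ AA s hc B n then 1 else 0 := by
  induction n generalizing x with
  | zero =>
    simp only [surv, hx, if_true]
    refine le_trans ?_ (ENNReal.le_tsum 1)
    simp only [KK, if_true, mul_one, one_mul]
    rw [if_pos]
    simp only [AA, Finset.mem_image, Finset.mem_product, Fintype.mem_piFinset, Finset.mem_Icc,
      Prod.exists]
    exact ⟨0, x, ⟨by simp, hx⟩, by simp [flowE_zero]⟩
  | succ n ih =>
    simp only [surv, hx, if_true, KK]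
    simp_rw [← ENNReal.tsum_mul_right]
    rw [ENNReal.tsum_comm]
    refine ENNReal.tsum_le_tsum fun p => ?_
    by_cases hp : x + ev p.1 p.2 ∈ B
    · calc _ ≤ w p * ∑' g, KK w (fun p => s p.1 ^ p.2) n g *
              (if tauS s (x + ev p.1 p.2) * g ∈ AA s hc B n then 1 else 0) := by
            gcongr; exact ih _ hp
        _ = ∑' g, w p * (KK w (fun p => s p.1 ^ p.2) n ((s p.1 ^ p.2)⁻¹ * g) *
              (if tauS s (x + ev p.1 p.2) * ((s p.1 ^ p.2)⁻¹ * g) ∈ AA s hc B n then 1 else 0)) := by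
            rw [← ENNReal.tsum_mul_left]
            rw [← (Equiv.mulLeft (s p.1 ^ p.2)⁻¹).tsum_eq]
            rfl
        _ ≤ _ := by
            refine ENNReal.tsum_le_tsum fun g => ?_
            rw [mul_assoc]
            refine mul_le_mul_right ?_ _
            refine mul_le_mul_right ?_ _
            split_ifs with h1 h2 <;> simp
            obtain ⟨k, hk, hk2⟩ := step_any s hc B hconv x p.1 p.2 hx hp
            apply h2
            have := AA_mul s hc B n k hk _ h1
            rw [← mul_assoc, ← hk2] at this
            simpa [mul_assoc] using this
    · have : surv w (fun p => ev p.1 p.2) B n (x + ev p.1 p.2) = 0 := by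
        cases n <;> simp [surv, hp]
      simp [this]

theorem lower_group (hc : ∀ a b : commutator G, a * b = b * a) (B : Finset (Fin r → ℤ))
    (h0 : (0 : Fin r → ℤ) ∈ B)
    (hconv : ∀ x i, ∀ m : ℕ, x ∈ B → x + ev i (m : ℤ) ∈ B → ∀ j : ℕ, j ≤ m → x + ev i (j : ℤ) ∈ B)
    (w : Fin r × ℤ → ℝ≥0∞) (hw : ∑' p, w p = 1) (hsym : ∀ i m, w (i, -m) = w (i, m)) (n : ℕ) :
    (surv w (fun p => ev p.1 p.2) B n 0).toReal ^ 2 ≤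
      ((2 * n + 1 : ℝ) ^ (B.card * r) * B.card) * (KK w (fun p => s p.1 ^ p.2) (2 * n) 1).toReal := by
  set K := KK w (fun p : Fin r × ℤ => s p.1 ^ p.2) with hK
  have hfin : ∀ n g, K n g ≠ ⊤ := fun n g =>
    ne_of_lt ((KK_le_one _ _ hw _ _).trans_lt (by simp))
  have hinv : ∀ g, K n g⁻¹ = K n g := by
    intro g
    refine KK_inv _ _ ((Equiv.refl _).prodCongr (Equiv.neg ℤ)) ?_ ?_ n g
    · rintro ⟨i, m⟩; exact hsym i m
    · rintro ⟨i, m⟩; simp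
  set A := AA s hc B n
  have h1 : surv w (fun p => ev p.1 p.2) B n 0 ≤ ∑ g ∈ A, K n g := by
    refine (surv_le s hc B hconv w n 0 h0).trans ?_
    rw [tsum_eq_sum (s := A)]
    · refine Finset.sum_le_sum fun g _ => ?_
      split_ifs <;> simp [hK]
    · intro g hg
      simp only [tauS_zero, one_mul]
      rw [if_neg hg, mul_zero]
  have h2 : ∑ g ∈ A, K n g ^ 2 ≤ K (2 * n) 1 := by
    rw [two_mul, hK, KK_add]
    refine le_trans ?_ (ENNReal.sum_le_tsum A)
    refine Finset.sum_le_sum fun g _ => ?_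
    rw [mul_one, ← hK, hinv, sq]
  have h1' : (surv w (fun p => ev p.1 p.2) B n 0).toReal ≤ ∑ g ∈ A, (K n g).toReal := by
    rw [← ENNReal.toReal_sum (fun g _ => hfin n g)]
    exact ENNReal.toReal_mono (ENNReal.sum_ne_top.2 fun g _ => hfin n g) h1
  have h2' : ∑ g ∈ A, (K n g).toReal ^ 2 ≤ (K (2 * n) 1).toReal := by
    simp_rw [← ENNReal.toReal_pow]
    rw [← ENNReal.toReal_sum (fun g _ => ENNReal.pow_ne_top (hfin n g))]
    exact ENNReal.toReal_mono (hfin _ _) h2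
  calc _ ≤ (∑ g ∈ A, (K n g).toReal) ^ 2 := by gcongr
    _ ≤ A.card * ∑ g ∈ A, (K n g).toReal ^ 2 := sq_sum_le_card_mul_sum_sq
    _ ≤ _ := by
      gcongr
      exact_mod_cast AA_card s hc B n

end Lower

/-! ## Part C: one dimensional estimates -/

section OneD

theorem rpow_step_pos (β : ℝ) (hβ : 0 < β) (k : ℝ) (hk : 1 ≤ k) :
    min 1 β * k ^ (β - 1) ≤ k ^ β - (k - 1) ^ β := by
  have hk0 : 0 < k := by linarith
  have ht : 0 ≤ 1 - 1 / k := by rw [sub_nonneg, div_le_one hk0]; exact hk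
  have e1 : (k - 1) ^ β = k ^ β * (1 - 1 / k) ^ β := by
    rw [← Real.mul_rpow hk0.le ht]; congr 1; field_simp
  have e2 : k ^ (β - 1) = k ^ β * (1 / k) := by
    rw [Real.rpow_sub hk0, Real.rpow_one]; ring
  have key : (1 - 1 / k) ^ β ≤ 1 - min 1 β * (1 / k) := by
    rcases le_total 1 β with h | h
    · rw [min_eq_left h]
      calc (1 - 1 / k) ^ β ≤ (1 - 1 / k) ^ (1:ℝ) := by
            apply Real.rpow_le_rpow_of_exponent_ge' ht _ (by norm_num) h
            have : 0 < 1 / k := by positivity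
            linarith
        _ = _ := by rw [Real.rpow_one]; ring
    · rw [min_eq_right h]
      have := rpow_one_add_le_one_add_mul_self (s := -(1/k)) (p := β) (by linarith) hβ.le h
      calc (1 - 1 / k) ^ β = (1 + -(1/k)) ^ β := by ring_nf
        _ ≤ _ := this
        _ = _ := by ring
  have hp : 0 < k ^ β := by positivity
  rw [e1, e2]
  nlinarith

theorem rpow_step_neg (a : ℝ) (ha : 0 < a) (k : ℝ) (hk : 1 < k) :
    a * k ^ (-1 - a) ≤ (k - 1) ^ (-a) - k ^ (-a) := by
  have hk0 : 0 < k := by linarith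
  have ht : 0 < 1 - 1 / k := by rw [sub_pos, div_lt_one hk0]; exact hk
  have e1 : (k - 1) ^ (-a) = k ^ (-a) * (1 - 1 / k) ^ (-a) := by
    rw [← Real.mul_rpow hk0.le ht.le]; congr 1; field_simp
  have e2 : k ^ (-1 - a) = k ^ (-a) * (1 / k) := by
    rw [show -1 - a = -a - 1 by ring, Real.rpow_sub hk0, Real.rpow_one]; ring
  have key : 1 + a * (1 / k) ≤ (1 - 1 / k) ^ (-a) := by
    rw [Real.rpow_def_of_pos ht]
    have h1 := Real.log_le_sub_one_of_pos ht
    have h2 := Real.add_one_le_exp (Real.log (1 - 1 / k) * (-a))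
    nlinarith
  have hp : 0 < k ^ (-a) := by positivity
  rw [e1, e2]
  nlinarith

theorem Icc_succ_sum (f : ℤ → ℝ) (M : ℕ) :
    ∑ m ∈ Finset.Icc (-((M+1 : ℕ):ℤ)) ((M+1 : ℕ):ℤ), f m =
      f (M+1) + f (-(M+1)) + ∑ m ∈ Finset.Icc (-(M:ℤ)) M, f m := by
  have : Finset.Icc (-((M+1 : ℕ):ℤ)) ((M+1 : ℕ):ℤ) =
      insert ((M:ℤ)+1) (insert (-((M:ℤ)+1)) (Finset.Icc (-(M:ℤ)) M)) := by
    ext; simp only [Finset.mem_Icc, Finset.mem_insert]; push_cast; omega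
  rw [this, Finset.sum_insert, Finset.sum_insert, add_assoc]
  · simp only [Finset.mem_Icc]; omega
  · simp only [Finset.mem_Icc, Finset.mem_insert]; omega

theorem sum_second_moment (a : ℝ) (h2 : a < 2) :
    ∃ C : ℝ, 0 < C ∧ ∀ M : ℕ, ∑ m ∈ Finset.Icc (-(M:ℤ)) M, (1 + |(m:ℝ)|) ^ (1 - a) ≤
      C * (1 + M : ℝ) ^ (2 - a) := by
  have hm : 0 < min 1 (2 - a) := lt_min one_pos (by linarith)
  refine ⟨2 / min 1 (2 - a), by positivity, fun M => ?_⟩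
  induction M with
  | zero =>
    simp
    rw [le_div_iff₀ hm]
    have := min_le_left (1:ℝ) (2 - a); linarith
  | succ M ih =>
    rw [Icc_succ_sum]
    have h := rpow_step_pos (2 - a) (by linarith) (M + 2) (by linarith [(Nat.cast_nonneg M : (0:ℝ) ≤ M)])
    have e1 : (1 + |(((M:ℤ)+1 : ℤ):ℝ)|) = M + 2 := by
      push_cast; rw [abs_of_nonneg (by positivity)]; ring
    have e2 : (1 + |((-((M:ℤ)+1) : ℤ):ℝ)|) = M + 2 := by
      push_cast; rw [abs_neg, abs_of_nonneg (by positivity)]; ring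
    rw [e1, e2]
    rw [show (2 - a - 1) = 1 - a by ring, show (M + 2 - 1 : ℝ) = 1 + M by ring] at h
    have h3 : 2 * (M + 2 : ℝ) ^ (1 - a) ≤ 2 / min 1 (2 - a) * (((M:ℝ) + 2) ^ (2 - a) - (1 + M) ^ (2 - a)) := by
      rw [div_mul_eq_mul_div, le_div_iff₀ hm]; nlinarith
    push_cast
    rw [show (1 + ((M:ℝ) + 1)) = M + 2 by ring]
    nlinarith

theorem sum_tail (a c : ℝ) (h0 : 0 < a) (hc : 0 < c)
    (hs : ∑' m : ℤ, c * (1 + |(m:ℝ)|) ^ (-1 - a) = 1) (M : ℕ) :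
    1 ≤ ∑ m ∈ Finset.Icc (-(M:ℤ)) M, c * (1 + |(m:ℝ)|) ^ (-1 - a)
      + 2 * c / a * (1 + M : ℝ) ^ (-a) := by
  have hsum : Summable fun m : ℤ => c * (1 + |(m:ℝ)|) ^ (-1 - a) := by
    by_contra h; rw [tsum_eq_zero_of_not_summable h] at hs; norm_num at hs
  set F : ℕ → ℝ := fun M => ∑ m ∈ Finset.Icc (-(M:ℤ)) M, c * (1 + |(m:ℝ)|) ^ (-1 - a)
      + 2 * c / a * (1 + M : ℝ) ^ (-a) with hF
  have hanti : Antitone F := by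
    refine antitone_nat_of_succ_le fun M => ?_
    simp only [hF]
    rw [Icc_succ_sum]
    have h := rpow_step_neg a h0 (M + 2) (by linarith [(Nat.cast_nonneg M : (0:ℝ) ≤ M)])
    have e1 : (1 + |(((M:ℤ)+1 : ℤ):ℝ)|) = M + 2 := by
      push_cast; rw [abs_of_nonneg (by positivity)]; ring
    have e2 : (1 + |((-((M:ℤ)+1) : ℤ):ℝ)|) = M + 2 := by
      push_cast; rw [abs_neg, abs_of_nonneg (by positivity)]; ring
    rw [e1, e2]
    rw [show (M + 2 - 1 : ℝ) = 1 + M by ring] at h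
    push_cast
    rw [show (1 + ((M:ℝ) + 1)) = M + 2 by ring]
    have : 2 * c / a * (a * (M + 2 : ℝ) ^ (-1 - a)) = 2 * (c * (M + 2 : ℝ) ^ (-1 - a)) := by
      field_simp
    have h4 := mul_le_mul_of_nonneg_left h (show 0 ≤ 2 * c / a by positivity)
    nlinarith
  have hlim : Filter.Tendsto (fun N : ℕ => ∑ m ∈ Finset.Icc (-(N:ℤ)) N, c * (1 + |(m:ℝ)|) ^ (-1 - a))
      Filter.atTop (nhds 1) := by
    have := hsum.hasSum
    rw [hs] at this
    refine this.comp ?_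
    refine Filter.tendsto_atTop_finset_of_monotone ?_ ?_
    · intro A B hAB x; simp only [Finset.mem_Icc]; omega
    · intro x; exact ⟨x.natAbs, by simp only [Finset.mem_Icc]; omega⟩
  refine le_of_tendsto hlim ?_
  filter_upwards [Filter.eventually_ge_atTop M] with N hN
  refine le_trans ?_ (hanti hN)
  simp only [hF]
  have : 0 ≤ 2 * c / a * (1 + N : ℝ) ^ (-a) := by positivity
  linarith

/-- test function -/
def uu (L : ℕ) (x : ℤ) : ℝ := max 0 (1 - ((x:ℝ) / L) ^ 2)

theorem uu_nonneg (L : ℕ) (x : ℤ) : 0 ≤ uu L x := le_max_left _ _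
theorem uu_le_one (L : ℕ) (x : ℤ) : uu L x ≤ 1 := by
  unfold uu; apply max_le (by norm_num); nlinarith [sq_nonneg ((x:ℝ)/L)]
theorem uu_zero (L : ℕ) : uu L 0 = 1 := by simp [uu]
theorem uu_out (L : ℕ) (hL : 0 < L) (x : ℤ) (hx : (L:ℤ) ≤ |x|) : uu L x = 0 := by
  unfold uu
  apply max_eq_left
  have h1 : (L:ℝ) ≤ |(x:ℝ)| := by exact_mod_cast hx
  have hL' : (0:ℝ) < L := by exact_mod_cast hL
  have : 1 ≤ |(x:ℝ) / L| := by rw [abs_div, abs_of_pos hL', le_div_iff₀ hL']; linarith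
  have : 1 ≤ ((x:ℝ)/L)^2 := by rw [← sq_abs]; nlinarith
  linarith

theorem oneD_main (a c : ℝ) (h0 : 0 < a) (h2 : a < 2) (hc : 0 < c)
    (hs : ∑' m : ℤ, c * (1 + |(m:ℝ)|) ^ (-1 - a) = 1) :
    ∃ C : ℝ, 0 < C ∧ ∃ L0 : ℕ, 1 ≤ L0 ∧ ∀ L : ℕ, L0 ≤ L → ∀ x : ℤ,
      (1 - C * (L:ℝ) ^ (-a)) * uu L x ≤ ∑' m : ℤ, c * (1 + |(m:ℝ)|) ^ (-1 - a) * uu L (x + m) := by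
  have hsum : Summable fun m : ℤ => c * (1 + |(m:ℝ)|) ^ (-1 - a) := by
    by_contra h; rw [tsum_eq_zero_of_not_summable h] at hs; norm_num at hs
  set p : ℤ → ℝ := fun m => c * (1 + |(m:ℝ)|) ^ (-1 - a) with hp
  have hp0 : ∀ m, 0 ≤ p m := fun m => by simp only [hp]; positivity
  obtain ⟨C1, hC1, hS1⟩ := sum_second_moment a h2
  set c5 : ℝ := c * 3 ^ (-1 - a) * (3 / 32) with hc5
  have hc5p : 0 < c5 := by positivity
  -- choose ε
  obtain ⟨ε, hε0, hε8, hε⟩ : ∃ ε : ℝ, 0 < ε ∧ ε ≤ 1/8 ∧ c * C1 * (2 * ε) ^ (2 - a) ≤ c5 := by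
    set y : ℝ := c5 / (c * C1)
    have hy : 0 < y := by positivity
    set b := y ^ (1 / (2 - a))
    have hb : 0 < b := by positivity
    refine ⟨min (1/8) (b / 2), by positivity, min_le_left _ _, ?_⟩
    have h1 : (2 * min (1/8) (b / 2)) ^ (2 - a) ≤ y := by
      calc (2 * min (1/8) (b / 2)) ^ (2 - a) ≤ b ^ (2 - a) := by
            apply Real.rpow_le_rpow (by positivity) _ (by linarith)
            have := min_le_right (1/8) (b/2); linarith
        _ = y := by
            rw [← Real.rpow_mul hy.le, one_div_mul_cancel (by linarith), Real.rpow_one]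
    calc c * C1 * (2 * min (1/8) (b / 2)) ^ (2 - a) ≤ c * C1 * y := by gcongr
      _ = c5 := by simp only [y]; field_simp
  refine ⟨2 * c / a * ε ^ (-a), by positivity, ⌈1/ε⌉₊ + 8, by omega, fun L hL x => ?_⟩
  have hL8 : 8 ≤ L := by omega
  have hLp : (0:ℝ) < L := by exact_mod_cast (by omega : 0 < L)
  have hLε : 1 ≤ ε * L := by
    have h1 : 1/ε ≤ L := (Nat.le_ceil _).trans (by exact_mod_cast (by omega : ⌈1/ε⌉₊ ≤ L))
    rw [div_le_iff₀ hε0] at h1; linarith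
  by_cases hx : (L:ℤ) ≤ |x|
  · rw [uu_out L (by omega) x hx, mul_zero]
    exact tsum_nonneg fun m => mul_nonneg (hp0 m) (uu_nonneg _ _)
  push Not at hx
  set M : ℕ := ⌊ε * L⌋₊ with hM
  have hM1 : (M:ℝ) ≤ ε * L := Nat.floor_le (by positivity)
  have hM2 : ε * L ≤ 1 + M := by have := Nat.lt_floor_add_one (ε * L); linarith
  have hMle : 8 * M ≤ L := by
    have : (8 * M : ℝ) ≤ L := by nlinarith
    exact_mod_cast this
  have hux : uu L x = 1 - ((x:ℝ)/L)^2 := by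
    unfold uu; apply max_eq_right
    have h1 : |(x:ℝ)| ≤ L := by exact_mod_cast hx.le
    have : |(x:ℝ) / L| ≤ 1 := by rw [abs_div, abs_of_pos hLp, div_le_one hLp]; exact h1
    have := (sq_le_one_iff_abs_le_one _).2 this
    linarith
  -- near part
  have hnear : uu L x * ∑ m ∈ Finset.Icc (-(M:ℤ)) M, p m - c5 * (L:ℝ) ^ (-a) ≤
      ∑ m ∈ Finset.Icc (-(M:ℤ)) M, p m * uu L (x + m) := by
    have h1 : ∀ m : ℤ, uu L x - 2 * x * m / L ^ 2 - (m:ℝ)^2 / L^2 ≤ uu L (x + m) := by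
      intro m
      rw [hux]
      refine le_trans (le_of_eq ?_) (le_max_right _ _)
      push_cast; field_simp; ring
    have h2 : ∑ m ∈ Finset.Icc (-(M:ℤ)) M, p m * (2 * x * m / L ^ 2) = 0 := by
      have hneg : ∑ m ∈ Finset.Icc (-(M:ℤ)) M, p m * (2 * x * m / L ^ 2) =
          ∑ m ∈ Finset.Icc (-(M:ℤ)) M, -(p m * (2 * x * m / L ^ 2)) := by
        refine Finset.sum_nbij' (fun m => -m) (fun m => -m) ?_ ?_ ?_ ?_ ?_
        · intro m; simp only [Finset.mem_Icc]; omega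
        · intro m; simp only [Finset.mem_Icc]; omega
        · simp
        · simp
        · intro m _; simp only [hp]; push_cast; rw [abs_neg]; ring
      rw [Finset.sum_neg_distrib] at hneg
      linarith
    have h3 : ∑ m ∈ Finset.Icc (-(M:ℤ)) M, p m * ((m:ℝ)^2 / L^2) ≤ c5 * (L:ℝ) ^ (-a) := by
      calc ∑ m ∈ Finset.Icc (-(M:ℤ)) M, p m * ((m:ℝ)^2 / L^2)
          ≤ ∑ m ∈ Finset.Icc (-(M:ℤ)) M, c / L^2 * (1 + |(m:ℝ)|) ^ (1 - a) := by
            refine Finset.sum_le_sum fun m _ => ?_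
            have hpos : 0 < 1 + |(m:ℝ)| := by positivity
            have e : (1 + |(m:ℝ)|) ^ (1 - a) = (1 + |(m:ℝ)|) ^ (-1 - a) * (1 + |(m:ℝ)|) ^ 2 := by
              rw [← Real.rpow_natCast, ← Real.rpow_add hpos]; norm_num; ring_nf
            have e2 : (m:ℝ)^2 ≤ (1 + |(m:ℝ)|) ^ 2 := by
              rw [← sq_abs]; gcongr; linarith
            simp only [hp]; rw [e]
            have h5 : 0 ≤ c * (1 + |(m:ℝ)|) ^ (-1 - a) / L^2 := by positivity
            calc _ = c * (1 + |(m:ℝ)|) ^ (-1 - a) / L^2 * (m:ℝ)^2 := by ring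
              _ ≤ c * (1 + |(m:ℝ)|) ^ (-1 - a) / L^2 * (1 + |(m:ℝ)|) ^ 2 := by gcongr
              _ = _ := by ring
        _ ≤ c / L^2 * (C1 * (1 + M : ℝ) ^ (2 - a)) := by
            rw [← Finset.mul_sum]; gcongr; exact hS1 M
        _ ≤ c / L^2 * (C1 * ((2 * ε) * L) ^ (2 - a)) := by
            gcongr
            · linarith
        _ = (c * C1 * (2 * ε) ^ (2 - a)) * (L:ℝ) ^ (-a) := by
            rw [Real.mul_rpow (by positivity) hLp.le]
            have : (L:ℝ) ^ (2 - a) = L^2 * (L:ℝ)^(-a) := by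
              rw [← Real.rpow_natCast, ← Real.rpow_add hLp]; norm_num; ring_nf
            rw [this]; field_simp
        _ ≤ _ := by gcongr
    calc uu L x * ∑ m ∈ Finset.Icc (-(M:ℤ)) M, p m - c5 * (L:ℝ) ^ (-a)
        ≤ uu L x * ∑ m ∈ Finset.Icc (-(M:ℤ)) M, p m
          - ∑ m ∈ Finset.Icc (-(M:ℤ)) M, p m * (2 * x * m / L ^ 2)
          - ∑ m ∈ Finset.Icc (-(M:ℤ)) M, p m * ((m:ℝ)^2 / L^2) := by rw [h2]; linarith
      _ = ∑ m ∈ Finset.Icc (-(M:ℤ)) M, p m * (uu L x - 2 * x * m / L ^ 2 - (m:ℝ)^2 / L^2) := by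
          rw [Finset.mul_sum, ← Finset.sum_sub_distrib, ← Finset.sum_sub_distrib]
          exact Finset.sum_congr rfl fun m _ => by ring
      _ ≤ _ := Finset.sum_le_sum fun m _ => mul_le_mul_of_nonneg_left (h1 m) (hp0 m)
  -- far part
  obtain ⟨J, hJd, hJ⟩ : ∃ J : Finset ℤ, Disjoint (Finset.Icc (-(M:ℤ)) M) J ∧
      c5 * (L:ℝ) ^ (-a) ≤ ∑ m ∈ J, p m * uu L (x + m) := by
    obtain ⟨sg, hsg, hsx⟩ : ∃ sg : ℤ, (sg = 1 ∨ sg = -1) ∧ 0 ≤ -(sg * x) := by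
      rcases le_total 0 x with h | h
      · exact ⟨-1, Or.inr rfl, by linarith⟩
      · exact ⟨1, Or.inl rfl, by linarith⟩
    have hinj : Function.Injective (fun j : ℕ => -x + sg * (j:ℤ)) := by
      intro j k hjk; rcases hsg with rfl | rfl <;> simp at hjk <;> omega
    refine ⟨(Finset.Icc (L/4+1) (L/2)).image (fun j : ℕ => -x + sg * (j:ℤ)), ?_, ?_⟩
    · rw [Finset.disjoint_left]
      intro m hm hm2
      simp only [Finset.mem_image, Finset.mem_Icc] at hm hm2
      obtain ⟨j, hj, rfl⟩ := hm2
      rcases hsg with rfl | rfl <;> omega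
    · rw [Finset.sum_image (fun _ _ _ _ h => hinj h)]
      have hterm : ∀ j ∈ Finset.Icc (L/4+1) (L/2),
          c * (3 * L : ℝ) ^ (-1 - a) * (3/4) ≤ p (-x + sg * (j:ℤ)) * uu L (x + (-x + sg * (j:ℤ))) := by
        intro j hj
        rw [Finset.mem_Icc] at hj
        have hj2 : (j:ℝ) ≤ L / 2 := by
          rw [le_div_iff₀ (by norm_num)]; exact_mod_cast (by omega : j * 2 ≤ L)
        have habs : |((-x + sg * (j:ℤ) : ℤ):ℝ)| ≤ 2 * L := by
          have h1 : |(x:ℝ)| ≤ L := by exact_mod_cast hx.le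
          have h1' := abs_le.1 h1
          rw [abs_le]; push_cast
          have hjn : (0:ℝ) ≤ j := Nat.cast_nonneg j
          rcases hsg with rfl | rfl <;> push_cast <;> constructor <;> linarith
        have hu : 3/4 ≤ uu L (x + (-x + sg * (j:ℤ))) := by
          refine le_trans ?_ (le_max_right _ _)
          have e : (((x + (-x + sg * (j:ℤ)) : ℤ):ℝ) / L)^2 = ((j:ℝ)/L)^2 := by
            rcases hsg with rfl | rfl <;> push_cast <;> ring
          rw [e]
          have h5 : (j:ℝ)/L ≤ 1/2 := by rw [div_le_iff₀ hLp]; linarith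
          have h6 : 0 ≤ (j:ℝ)/L := by positivity
          nlinarith
        have hpj : c * (3 * L : ℝ) ^ (-1 - a) ≤ p (-x + sg * (j:ℤ)) := by
          simp only [hp]
          refine mul_le_mul_of_nonneg_left ?_ hc.le
          apply Real.rpow_le_rpow_of_nonpos (by positivity) _ (by linarith)
          have : (8:ℝ) ≤ L := by exact_mod_cast hL8
          linarith
        exact mul_le_mul hpj hu (by norm_num) (hp0 _)
      refine le_trans ?_ (Finset.card_nsmul_le_sum _ _ _ hterm)
      rw [nsmul_eq_mul, Nat.card_Icc]
      have hcard : (L:ℝ) / 8 ≤ ((L/2 + 1 - (L/4+1) : ℕ):ℝ) := by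
        rw [div_le_iff₀ (by norm_num)]
        exact_mod_cast (by omega : L ≤ (L/2 + 1 - (L/4+1)) * 8)
      calc c5 * (L:ℝ) ^ (-a) = L / 8 * (c * (3 * L : ℝ) ^ (-1 - a) * (3/4)) := by
            rw [Real.mul_rpow (by norm_num) hLp.le, hc5]
            have : (L:ℝ) ^ (-a) = L * (L:ℝ)^(-1-a) := by
              nth_rw 2 [← Real.rpow_one (L:ℝ)]
              rw [← Real.rpow_add hLp]; ring_nf
            rw [this]; ring
        _ ≤ _ := by gcongr
  have hsum2 : Summable fun m : ℤ => p m * uu L (x + m) :=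
    Summable.of_nonneg_of_le (fun m => mul_nonneg (hp0 m) (uu_nonneg _ _))
      (fun m => mul_le_of_le_one_right (hp0 m) (uu_le_one _ _)) hsum
  have hfin : ∑ m ∈ Finset.Icc (-(M:ℤ)) M, p m * uu L (x + m) + ∑ m ∈ J, p m * uu L (x + m) ≤
      ∑' m : ℤ, p m * uu L (x + m) := by
    rw [← Finset.sum_union hJd]
    exact hsum2.sum_le_tsum _ fun m _ => mul_nonneg (hp0 m) (uu_nonneg _ _)
  have htail := sum_tail a c h0 hc hs M
  have hMa : (1 + M : ℝ) ^ (-a) ≤ ε ^ (-a) * (L:ℝ) ^ (-a) := by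
    rw [← Real.mul_rpow hε0.le hLp.le]
    exact Real.rpow_le_rpow_of_nonpos (by positivity) hM2 (by linarith)
  have hX : (1 - 2 * c / a * ε ^ (-a) * (L:ℝ) ^ (-a)) ≤ ∑ m ∈ Finset.Icc (-(M:ℤ)) M, p m := by
    have : 2 * c / a * (1 + M : ℝ) ^ (-a) ≤ 2 * c / a * (ε ^ (-a) * (L:ℝ) ^ (-a)) := by gcongr
    simp only [hp]; linarith
  have := mul_le_mul_of_nonneg_right hX (uu_nonneg L x)
  linarith
end OneD

/-! ## Part D: weights, rates, and the lower bound -/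

theorem surv_le_one {r : ℕ} {Ω : Type*} (w : Ω → ℝ≥0∞) (d : Ω → (Fin r → ℤ))
    (B : Finset (Fin r → ℤ)) (hw : ∑' ω, w ω = 1) (n : ℕ) (x : Fin r → ℤ) :
    surv w d B n x ≤ 1 := by
  induction n generalizing x with
  | zero => simp only [surv]; split_ifs <;> simp
  | succ m ih =>
    simp only [surv]; split_ifs
    · calc _ ≤ ∑' p, w p * 1 := ENNReal.tsum_le_tsum fun p => by
              gcongr; exact ih _
        _ = 1 := by simpa using hw
    · simp

/-- weights of the steps -/
def wt {r : ℕ} (α c : Fin r → ℝ) (p : Fin r × ℤ) : ℝ≥0∞ :=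
  ENNReal.ofReal ((1 / (r:ℝ)) * (c p.1 * (1 + |(p.2 : ℝ)|) ^ (-1 - α p.1)))

section
variable {r : ℕ} (α c : Fin r → ℝ)

theorem wt_summable (hnorm : ∀ i, ∑' m : ℤ, c i * (1 + |(m : ℝ)|) ^ (-1 - α i) = 1) (i : Fin r) :
    Summable fun m : ℤ => c i * (1 + |(m : ℝ)|) ^ (-1 - α i) := by
  by_contra h
  have := hnorm i
  rw [tsum_eq_zero_of_not_summable h] at this; norm_num at this

theorem wt_sum (hr : 2 ≤ r) (hc : ∀ i, 0 < c i)
    (hnorm : ∀ i, ∑' m : ℤ, c i * (1 + |(m : ℝ)|) ^ (-1 - α i) = 1) :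
    ∑' p, wt α c p = 1 := by
  have hr0 : (0:ℝ) < r := by exact_mod_cast (by omega : 0 < r)
  rw [ENNReal.tsum_prod']
  have : ∀ i : Fin r, ∑' m : ℤ, wt α c (i, m) = ENNReal.ofReal (1 / r) := by
    intro i
    simp only [wt]
    rw [← ENNReal.ofReal_tsum_of_nonneg]
    · rw [tsum_mul_left, hnorm, mul_one]
    · intro m; have := hc i; positivity
    · exact (wt_summable α c hnorm i).mul_left _
  simp_rw [this]
  rw [tsum_fintype]
  simp only [Finset.sum_const, Finset.card_univ, Fintype.card_fin, nsmul_eq_mul]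
  rw [← ENNReal.ofReal_natCast, ← ENNReal.ofReal_mul (by positivity)]
  rw [mul_one_div_cancel hr0.ne']; simp

theorem wt_symm (i : Fin r) (m : ℤ) : wt α c (i, -m) = wt α c (i, m) := by
  simp [wt]

theorem multiD (hr : 2 ≤ r) (hα : ∀ i, 0 < α i ∧ α i < 2) (hc : ∀ i, 0 < c i)
    (hnorm : ∀ i, ∑' m : ℤ, c i * (1 + |(m : ℝ)|) ^ (-1 - α i) = 1) :
    ∃ C : ℝ, 0 < C ∧ ∃ L0 : ℕ, 1 ≤ L0 ∧ ∀ (L : Fin r → ℕ), (∀ i, L0 ≤ L i) → ∀ q : ℝ,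
      (∀ i, (L i : ℝ) ^ (-α i) ≤ q) → ∀ x : Fin r → ℤ,
      ENNReal.ofReal (1 - C * q) * ENNReal.ofReal (∏ j, uu (L j) (x j)) ≤
        ∑' p, wt α c p * ENNReal.ofReal (∏ j, uu (L j) ((x + ev p.1 p.2) j)) := by
  have hr0 : (0:ℝ) < r := by exact_mod_cast (by omega : 0 < r)
  choose C hC L0 hL01 hmain using fun i =>
    oneD_main (α i) (c i) (hα i).1 (hα i).2 (hc i) (hnorm i)
  have hC0 : ∀ i, C i ≤ ∑ i, C i := fun i =>
    Finset.single_le_sum (f := C) (fun j _ => (hC j).le) (Finset.mem_univ i)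
  have hL00 : ∀ i, L0 i ≤ ∑ i, L0 i := fun i =>
    Finset.single_le_sum (f := L0) (fun j _ => Nat.zero_le _) (Finset.mem_univ i)
  have hi0 : Fin r := ⟨0, by omega⟩
  refine ⟨∑ i, C i, (hC hi0).trans_le (hC0 hi0), ∑ i, L0 i, (hL01 hi0).trans (hL00 hi0), ?_⟩
  intro L hL q hq x
  have hprod : ∀ (i : Fin r) (m : ℤ), ∏ j, uu (L j) ((x + ev i m) j) =
      uu (L i) (x i + m) * ∏ j ∈ Finset.univ.erase i, uu (L j) (x j) := by
    intro i m
    rw [← Finset.mul_prod_erase _ _ (Finset.mem_univ i)]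
    congr 1
    · simp [ev]
    · refine Finset.prod_congr rfl fun j hj => ?_
      have : j ≠ i := Finset.ne_of_mem_erase hj
      simp [ev, this]
  rw [ENNReal.tsum_prod']
  have key : ∀ i : Fin r, ENNReal.ofReal (1 / r * ((1 - (∑ i, C i) * q) * ∏ j, uu (L j) (x j))) ≤
      ∑' m : ℤ, wt α c (i, m) * ENNReal.ofReal (∏ j, uu (L j) ((x + ev i m) j)) := by
    intro i
    set rest := ∏ j ∈ Finset.univ.erase i, uu (L j) (x j) with hrest
    have hrest0 : 0 ≤ rest := Finset.prod_nonneg fun j _ => uu_nonneg _ _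
    have hp0 : ∀ m : ℤ, 0 ≤ c i * (1 + |(m : ℝ)|) ^ (-1 - α i) := fun m => by
      have := hc i; positivity
    have hsum2 : Summable fun m : ℤ => c i * (1 + |(m : ℝ)|) ^ (-1 - α i) * uu (L i) (x i + m) :=
      Summable.of_nonneg_of_le (fun m => mul_nonneg (hp0 m) (uu_nonneg _ _))
        (fun m => mul_le_of_le_one_right (hp0 m) (uu_le_one _ _)) (wt_summable α c hnorm i)
    have e1 : ∀ m : ℤ, wt α c (i, m) * ENNReal.ofReal (∏ j, uu (L j) ((x + ev i m) j)) =
        ENNReal.ofReal ((1 / r * rest) *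
          (c i * (1 + |(m : ℝ)|) ^ (-1 - α i) * uu (L i) (x i + m))) := by
      intro m
      rw [hprod, wt, ← ENNReal.ofReal_mul (mul_nonneg (by positivity) (hp0 m))]
      congr 1; ring
    simp_rw [e1]
    rw [← ENNReal.ofReal_tsum_of_nonneg]
    · apply ENNReal.ofReal_le_ofReal
      rw [tsum_mul_left, ← Finset.mul_prod_erase _ _ (Finset.mem_univ i), ← hrest]
      have h1 := hmain i (L i) ((hL00 i).trans (hL i)) (x i)
      have h2 : (1 - (∑ i, C i) * q) * uu (L i) (x i) ≤
          (1 - C i * (L i:ℝ) ^ (-α i)) * uu (L i) (x i) := by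
        refine mul_le_mul_of_nonneg_right ?_ (uu_nonneg _ _)
        have hL0' : 0 ≤ (L i:ℝ) ^ (-α i) := by positivity
        have : C i * (L i:ℝ) ^ (-α i) ≤ (∑ i, C i) * q :=
          mul_le_mul (hC0 i) (hq i) hL0' ((hC i).le.trans (hC0 i))
        linarith
      calc _ = (1 / r * rest) * ((1 - (∑ i, C i) * q) * uu (L i) (x i)) := by ring
        _ ≤ _ := mul_le_mul_of_nonneg_left (h2.trans h1) (by positivity)
    · intro m; exact mul_nonneg (by positivity) (mul_nonneg (hp0 m) (uu_nonneg _ _))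
    · exact hsum2.mul_left _
  rw [tsum_fintype]
  refine le_trans ?_ (Finset.sum_le_sum fun i _ => key i)
  simp only [Finset.sum_const, Finset.card_univ, Fintype.card_fin, nsmul_eq_mul]
  rw [← ENNReal.ofReal_mul' (Finset.prod_nonneg fun j _ => uu_nonneg _ _), ← ENNReal.ofReal_natCast,
    ← ENNReal.ofReal_mul (by positivity), ← mul_assoc, mul_one_div_cancel hr0.ne', one_mul]

end

/-! rates -/
/-- time scale -/
def RR (r : ℕ) (ab : ℝ) (n : ℕ) : ℝ := ((n:ℝ) / Real.log n) ^ (ab / (r + ab))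
/-- volume scale -/
def VV (r : ℕ) (ab : ℝ) (n : ℕ) : ℝ := ((n:ℝ) / Real.log n) ^ ((r:ℝ) / (r + ab))
/-- the exponent -/
def QQ (r : ℕ) (ab : ℝ) (n : ℕ) : ℝ :=
  (n : ℝ) ^ ((r : ℝ) / ((r : ℝ) + ab)) * (Real.log n) ^ (ab / ((r : ℝ) + ab))

section
variable (r : ℕ) (ab : ℝ)

theorem log_ge_one {n : ℕ} (hn : 3 ≤ n) : 1 ≤ Real.log n := by
  rw [Real.le_log_iff_exp_le (by positivity)]
  have : (3:ℝ) ≤ n := by exact_mod_cast hn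
  linarith [Real.exp_one_lt_d9]

theorem rate_V (hab : 0 < ab) {n : ℕ} (hn : 3 ≤ n) : VV r ab n * Real.log n = QQ r ab n := by
  have hl := log_ge_one hn
  have hn0 : (0:ℝ) < n := by positivity
  unfold VV QQ
  rw [Real.div_rpow hn0.le (by linarith), div_mul_eq_mul_div, mul_div_assoc]
  congr 1
  have : (Real.log n) = Real.log n ^ (1:ℝ) := by simp
  nth_rw 1 [this]
  rw [← Real.rpow_sub (by linarith)]
  congr 1; field_simp; ring

theorem rate_R (hab : 0 < ab) {n : ℕ} (hn : 3 ≤ n) : (n:ℝ) / RR r ab n = QQ r ab n := by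
  have hl := log_ge_one hn
  have hn0 : (0:ℝ) < n := by positivity
  unfold RR QQ
  rw [Real.div_rpow hn0.le (by linarith), div_div_eq_mul_div, mul_comm, mul_div_assoc, mul_comm]
  congr 1
  have : (n:ℝ) = (n:ℝ) ^ (1:ℝ) := by simp
  nth_rw 1 [this]
  rw [← Real.rpow_sub hn0]
  congr 1; field_simp; ring

theorem rate_RV (hab : 0 < ab) {n : ℕ} (hn : 3 ≤ n) : RR r ab n ^ ((r:ℝ)/ab) = VV r ab n := by
  have hl := log_ge_one hn
  unfold RR VV
  rw [← Real.rpow_mul (by positivity)]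
  congr 1; field_simp

theorem n_div_log_tendsto : Filter.Tendsto (fun n : ℕ => (n:ℝ) / Real.log n) Filter.atTop Filter.atTop := by
  have h : Filter.Tendsto (fun x : ℝ => x / Real.log x) Filter.atTop Filter.atTop := by
    have h1 := Real.isLittleO_log_id_atTop
    have h2 : Filter.Tendsto (fun x : ℝ => Real.log x / x) Filter.atTop (nhdsWithin 0 (Set.Ioi 0)) := by
      refine tendsto_nhdsWithin_iff.2 ⟨h1.tendsto_div_nhds_zero, ?_⟩
      filter_upwards [Filter.eventually_gt_atTop 1] with x hx
      have := Real.log_pos hx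
      simp only [Set.mem_Ioi]; positivity
    refine (h2.inv_tendsto_nhdsGT_zero).congr fun x => ?_
    simp
  exact h.comp tendsto_natCast_atTop_atTop

theorem RR_tendsto (hab : 0 < ab) : Filter.Tendsto (RR r ab) Filter.atTop Filter.atTop :=
  (tendsto_rpow_atTop (by positivity)).comp n_div_log_tendsto

theorem VV_tendsto (hab : 0 < ab) (hr : 2 ≤ r) : Filter.Tendsto (VV r ab) Filter.atTop Filter.atTop :=
  (tendsto_rpow_atTop (by have : 0 < (r:ℝ) := by exact_mod_cast (by omega : 0 < r)
                          positivity)).comp n_div_log_tendsto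

theorem QQ_tendsto (hab : 0 < ab) (hr : 2 ≤ r) : Filter.Tendsto (QQ r ab) Filter.atTop Filter.atTop := by
  refine Filter.tendsto_atTop_mono' _ ?_ (VV_tendsto r ab hab hr)
  filter_upwards [Filter.eventually_ge_atTop 3, (VV_tendsto r ab hab hr).eventually_ge_atTop 0] with n hn hV
  rw [← rate_V r ab hab hn]
  nlinarith [log_ge_one hn]

theorem prod_R (hab : 0 < ab) (α : Fin r → ℝ) (hr : 2 ≤ r)
    (hαbar : 1 / ab = (1 / (r : ℝ)) * ∑ i : Fin r, 1 / α i) (R : ℝ) (hR : 0 < R) :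
    ∏ i, R ^ (1 / α i) = R ^ ((r:ℝ)/ab) := by
  have hr0 : (0:ℝ) < r := by exact_mod_cast (by omega : 0 < r)
  rw [← Real.rpow_sum_of_pos hR]
  congr 1
  rw [div_eq_mul_one_div, hαbar, ← mul_assoc, mul_one_div_cancel hr0.ne', one_mul]
end

theorem one_sub_ge_exp (t : ℝ) (h0 : 0 ≤ t) (h1 : t ≤ 1/2) : Real.exp (-(2*t)) ≤ 1 - t := by
  have h := Real.add_one_le_exp (2*t)
  rw [Real.exp_neg, inv_le_iff_one_le_mul₀ (Real.exp_pos _)]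
  nlinarith

theorem lower_final {r : ℕ} (α c : Fin r → ℝ) (ab : ℝ) (hab : 0 < ab)
    (hr : 2 ≤ r) (hα : ∀ i, 0 < α i ∧ α i < 2) (hc : ∀ i, 0 < c i)
    (hnorm : ∀ i, ∑' m : ℤ, c i * (1 + |(m : ℝ)|) ^ (-1 - α i) = 1)
    (hαbar : 1 / ab = (1 / (r : ℝ)) * ∑ i : Fin r, 1 / α i)
    {G : Type*} [Group G] (s : Fin r → G) (hcom : ∀ a b : commutator G, a * b = b * a) :
    ∃ C : ℝ, 1 ≤ C ∧ ∃ n₀ : ℕ, ∀ n : ℕ, n₀ ≤ n →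
      Real.exp (-C * QQ r ab n) ≤ (KK (wt α c) (fun p => s p.1 ^ p.2) n 1).toReal := by
  have hr0 : (0:ℝ) < r := by exact_mod_cast (by omega : 0 < r)
  obtain ⟨C, hC, L0, hL01, hmul⟩ := multiD α c hr hα hc hnorm
  have hsum := wt_sum α c hr hc hnorm
  have hfin : ∀ n g, KK (wt α c) (fun p => s p.1 ^ p.2) n g ≠ ⊤ := fun n g =>
    ne_of_lt ((KK_le_one _ _ hsum _ _).trans_lt (by simp))
  set i0 : Fin r := ⟨0, by omega⟩
  set w0 : ℝ := 1 / r * c i0 with hw0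
  have hw0p : 0 < w0 := by have := hc i0; positivity
  have hev : ∀ᶠ n : ℕ in Filter.atTop, 3 ≤ n ∧ 1 ≤ RR r ab n ∧ 2 * C ≤ RR r ab n ∧
      1 ≤ QQ r ab n ∧ -Real.log w0 ≤ QQ r ab n ∧ ∀ i, (L0:ℝ) ^ (α i) ≤ RR r ab n := by
    have h1 := RR_tendsto r ab hab
    have h2 := QQ_tendsto r ab hab hr
    filter_upwards [Filter.eventually_ge_atTop 3, h1.eventually_ge_atTop 1,
      h1.eventually_ge_atTop (2*C), h2.eventually_ge_atTop 1, h2.eventually_ge_atTop (-Real.log w0),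
      Filter.eventually_all.2 fun i => h1.eventually_ge_atTop ((L0:ℝ) ^ (α i))] with n a1 a2 a3 a4 a5 a6
    exact ⟨a1, a2, a3, a4, a5, a6⟩
  obtain ⟨n₀, hn₀⟩ := Filter.eventually_atTop.1 hev
  have h5r : (0:ℝ) < 5 ^ r := by positivity
  refine ⟨2 * C + (2 * r + 1) * 5 ^ r + 1, ?_, n₀, fun n hn => ?_⟩
  · have : 0 ≤ (2 * (r:ℝ) + 1) * 5 ^ r := by positivity
    linarith
  obtain ⟨hn3, hR1, hRC, hQ1, hQw, hRL⟩ := hn₀ n hn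
  set R := RR r ab n
  set Q := QQ r ab n
  set V := VV r ab n
  have hRp : 0 < R := by linarith
  have hl := log_ge_one hn3
  have hVQ : V * Real.log n = Q := rate_V r ab hab hn3
  have hRQ : (n:ℝ) / R = Q := rate_R r ab hab hn3
  have hVp : 0 < V := by
    have : 0 < V * Real.log n := by rw [hVQ]; linarith
    exact pos_of_mul_pos_left this (by linarith)
  set L : Fin r → ℕ := fun i => ⌈R ^ (1 / α i)⌉₊ with hLdef
  have hLge : ∀ i, R ^ (1 / α i) ≤ L i := fun i => Nat.le_ceil _
  have hRi1 : ∀ i, 1 ≤ R ^ (1 / α i) := fun i => Real.one_le_rpow hR1 (by have := (hα i).1; positivity)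
  have hLle : ∀ i, (L i : ℝ) ≤ 2 * R ^ (1 / α i) := fun i => by
    have := Nat.ceil_lt_add_one (show 0 ≤ R ^ (1 / α i) by positivity)
    have := hRi1 i
    simp only [hLdef]; linarith
  have hL0 : ∀ i, L0 ≤ L i := fun i => by
    have h1 : (L0:ℝ) ≤ R ^ (1 / α i) := by
      have h2 := Real.rpow_le_rpow (by positivity) (hRL i) (show 0 ≤ 1 / α i by have := (hα i).1; positivity)
      rwa [← Real.rpow_mul (by positivity), mul_one_div_cancel (hα i).1.ne', Real.rpow_one] at h2
    exact_mod_cast h1.trans (hLge i)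
  have hq : ∀ i, (L i : ℝ) ^ (-α i) ≤ 1 / R := fun i => by
    calc (L i : ℝ) ^ (-α i) ≤ (R ^ (1 / α i)) ^ (-α i) :=
          Real.rpow_le_rpow_of_nonpos (by positivity) (hLge i) (by linarith [(hα i).1])
      _ = 1 / R := by
          rw [← Real.rpow_mul hRp.le, mul_neg, one_div_mul_cancel (hα i).1.ne', Real.rpow_neg_one, one_div]
  set B : Finset (Fin r → ℤ) := Fintype.piFinset fun i => Finset.Icc (-(L i : ℤ)) (L i) with hB
  have h0B : (0 : Fin r → ℤ) ∈ B := by simp [hB]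
  have hconv : ∀ x i, ∀ m : ℕ, x ∈ B → x + ev i (m : ℤ) ∈ B → ∀ j : ℕ, j ≤ m → x + ev i (j : ℤ) ∈ B := by
    intro x i m hx hxm j hj
    simp only [hB, Fintype.mem_piFinset, Finset.mem_Icc, Pi.add_apply] at hx hxm ⊢
    intro k
    have h1 := hx k
    have h2 := hxm k
    by_cases hk : k = i
    · subst hk; simp [ev] at h2 ⊢; omega
    · simp [ev, hk] at h2 ⊢; omega
  have hBcard : (B.card : ℝ) ≤ 5 ^ r * V := by
    rw [hB, Fintype.card_piFinset]
    push_cast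
    calc ∏ i, ((Finset.Icc (-(L i : ℤ)) (L i)).card : ℝ) ≤ ∏ i, (5 * R ^ (1 / α i)) := by
          refine Finset.prod_le_prod (fun i _ => by positivity) fun i _ => ?_
          rw [Int.card_Icc, show ((L i:ℤ) + 1 - -(L i:ℤ)).toNat = 2 * L i + 1 by omega]
          push_cast
          linarith [hLle i, hRi1 i]
      _ = 5 ^ r * V := by
          rw [Finset.prod_mul_distrib, prod_R r ab hab α hr hαbar R hRp, rate_RV r ab hab hn3]
          simp [V]
  have hB1 : (1:ℝ) ≤ B.card := by
    exact_mod_cast Finset.card_pos.2 ⟨0, h0B⟩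
  set U : (Fin r → ℤ) → ℝ≥0∞ := fun x => ENNReal.ofReal (∏ j, uu (L j) (x j)) with hU
  have ht : C * (1 / R) ≤ 1/2 := by
    rw [mul_one_div, div_le_iff₀ hRp]; linarith
  have hsurv : ∀ m : ℕ, Real.exp (-(2 * (C * (1/R)))) ^ m ≤
      (surv (wt α c) (fun p => ev p.1 p.2) B m 0).toReal := by
    intro m
    have h1 := surv_ge (wt α c) (fun p => ev p.1 p.2) B U (ENNReal.ofReal (1 - C * (1/R))) ?_ ?_
      (hmul L hL0 (1/R) hq) m 0
    · have hU0 : U 0 = 1 := by simp [hU, uu_zero]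
      rw [hU0, mul_one, ← ENNReal.ofReal_pow (by linarith)] at h1
      have hle1 : surv (wt α c) (fun p => ev p.1 p.2) B m 0 ≠ ⊤ := by
        exact ne_of_lt ((surv_le_one _ _ _ hsum _ _).trans_lt (by simp))
      refine le_trans ?_ (ENNReal.toReal_mono hle1 h1)
      rw [ENNReal.toReal_ofReal (pow_nonneg (by linarith) _)]
      exact pow_le_pow_left₀ (Real.exp_pos _).le (one_sub_ge_exp _ (by positivity) ht) _
    · intro x
      exact ENNReal.ofReal_le_one.2 (Finset.prod_le_one (fun _ _ => uu_nonneg _ _) (fun _ _ => uu_le_one _ _))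
    · intro x hx
      simp only [hB, Fintype.mem_piFinset, Finset.mem_Icc, not_forall] at hx
      obtain ⟨i, hi⟩ := hx
      simp only [hU]
      rw [Finset.prod_eq_zero (Finset.mem_univ i), ENNReal.ofReal_zero]
      apply uu_out
      · have := hL0 i; omega
      · rw [le_abs]; omega
  set m := n / 2 with hm
  have hm1 : 2 * m ≤ n := by omega
  -- the bound at 2 m
  have hlow := lower_group s hcom B h0B hconv (wt α c) hsum (wt_symm α c) m
  set K := (KK (wt α c) (fun p => s p.1 ^ p.2) (2 * m) 1).toReal with hK
  have hn0 : (0:ℝ) < n := by positivity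
  have hm' : (2 * m : ℝ) ≤ n := by exact_mod_cast hm1
  have hden : ((2 * m + 1 : ℝ) ^ (B.card * r) * B.card) ≤ Real.exp ((2 * r + 1) * 5 ^ r * Q) := by
    have h1 : (2 * m + 1 : ℝ) ≤ Real.exp (2 * Real.log n) := by
      rw [two_mul (Real.log n), Real.exp_add, Real.exp_log hn0]
      have : (3:ℝ) ≤ n := by exact_mod_cast hn3
      nlinarith
    have h2 : (B.card : ℝ) ≤ Real.exp B.card := by linarith [Real.add_one_le_exp (B.card:ℝ)]
    calc ((2 * m + 1 : ℝ) ^ (B.card * r) * B.card)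
        ≤ Real.exp (2 * Real.log n) ^ (B.card * r) * Real.exp B.card := by gcongr
      _ = Real.exp (2 * r * (B.card * Real.log n) + B.card) := by
          rw [← Real.exp_nat_mul, ← Real.exp_add]; push_cast; ring_nf
      _ ≤ _ := by
          apply Real.exp_le_exp.2
          have h3 : (B.card:ℝ) * Real.log n ≤ 5 ^ r * Q := by
            rw [← hVQ, ← mul_assoc]; gcongr
          have h4 : (B.card:ℝ) ≤ B.card * Real.log n := by nlinarith
          nlinarith
  have hnum : Real.exp (-(2 * C * Q)) ≤ (surv (wt α c) (fun p => ev p.1 p.2) B m 0).toReal ^ 2 := by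
    calc Real.exp (-(2 * C * Q)) ≤ (Real.exp (-(2 * (C * (1/R)))) ^ m) ^ 2 := by
          rw [← pow_mul, ← Real.exp_nat_mul]
          apply Real.exp_le_exp.2
          push_cast
          have : (m:ℝ) * 2 * (2 * (C * (1/R))) ≤ 2 * C * Q := by
            rw [← hRQ]
            calc (m:ℝ) * 2 * (2 * (C * (1/R))) = 2 * C * ((2 * m) / R) := by ring
              _ ≤ _ := by gcongr
          linarith
      _ ≤ _ := by gcongr; exact hsurv m
  have hKlow : Real.exp (-(2 * C + (2 * r + 1) * 5 ^ r) * Q) ≤ K := by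
    have h1 : Real.exp (-(2 * C * Q)) ≤ Real.exp ((2 * r + 1) * 5 ^ r * Q) * K :=
      hnum.trans (hlow.trans (mul_le_mul_of_nonneg_right hden ENNReal.toReal_nonneg))
    rw [show -(2 * C + (2 * r + 1) * 5 ^ r) * Q = -(2 * C * Q) - (2 * r + 1) * 5 ^ r * Q by ring,
      Real.exp_sub, div_le_iff₀ (Real.exp_pos _)]
    linarith
  have hfinal : w0 * K ≤ (KK (wt α c) (fun p => s p.1 ^ p.2) n 1).toReal ∨
      K ≤ (KK (wt α c) (fun p => s p.1 ^ p.2) n 1).toReal := by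
    rcases Nat.even_or_odd' n with ⟨k, hk | hk⟩
    · right
      have : n = 2 * m := by omega
      rw [hK, ← this]
    · left
      have : n = 2 * m + 1 := by omega
      have h1 : wt α c (i0, 0) * KK (wt α c) (fun p => s p.1 ^ p.2) (2 * m) 1 ≤
          KK (wt α c) (fun p => s p.1 ^ p.2) n 1 := by
        rw [this]
        refine le_trans ?_ (ENNReal.le_tsum (i0, 0))
        simp
      have h2 := ENNReal.toReal_mono (hfin _ _) h1
      rw [ENNReal.toReal_mul] at h2
      refine le_trans (le_of_eq ?_) h2
      congr 1
      simp only [wt, hw0]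
      rw [ENNReal.toReal_ofReal] <;> simp
      have := hc i0; positivity
  rcases hfinal with h | h
  · refine le_trans ?_ h
    rw [show -(2 * C + (2 * r + 1) * 5 ^ r + 1) * Q = -Q + -(2 * C + (2 * r + 1) * 5 ^ r) * Q by ring,
      Real.exp_add]
    gcongr
    rw [← Real.le_log_iff_exp_le hw0p]; linarith
  · refine le_trans ?_ h
    refine le_trans ?_ hKlow
    apply Real.exp_le_exp.2
    linarith

/-! ## Part E: histories and the lamp group -/

/-- expectation over the next `n` steps, as a function of the history (most recent step first) -/
def EE {Ω : Type*} (W : Ω → ℝ≥0∞) : ℕ → (List Ω → ℝ≥0∞) → List Ω → ℝ≥0∞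
  | 0, F => F
  | n + 1, F => fun h => ∑' a, W a * EE W n F (a :: h)

section
variable {Ω : Type*} (W : Ω → ℝ≥0∞)

theorem EE_add (m n : ℕ) (F : List Ω → ℝ≥0∞) (h : List Ω) :
    EE W (m + n) F h = EE W m (EE W n F) h := by
  induction m generalizing h with
  | zero => simp [EE]
  | succ m ih =>
    rw [show m + 1 + n = (m + n) + 1 by ring]
    simp only [EE]
    simp_rw [ih]

theorem EE_mono (n : ℕ) (F G : List Ω → ℝ≥0∞) (h : List Ω)
    (hFG : ∀ h', h'.length = n + h.length → h <:+ h' → F h' ≤ G h') : EE W n F h ≤ EE W n G h := by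
  induction n generalizing h with
  | zero => exact hFG h (by simp) (List.suffix_refl _)
  | succ n ih =>
    simp only [EE]
    refine ENNReal.tsum_le_tsum fun a => ?_
    gcongr
    refine ih _ fun h' hl hs => hFG h' ?_ ((List.suffix_cons a h).trans hs)
    rw [hl, List.length_cons]; ring

theorem EE_const_mul (n : ℕ) (F : List Ω → ℝ≥0∞) (c : ℝ≥0∞) (h : List Ω) :
    EE W n (fun h => c * F h) h = c * EE W n F h := by
  induction n generalizing h with
  | zero => rfl
  | succ n ih =>
    simp only [EE, ih]
    rw [← ENNReal.tsum_mul_left]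
    exact tsum_congr fun a => by ring

theorem EE_add_fun (n : ℕ) (F G : List Ω → ℝ≥0∞) (h : List Ω) :
    EE W n (fun h => F h + G h) h = EE W n F h + EE W n G h := by
  induction n generalizing h with
  | zero => rfl
  | succ n ih =>
    simp only [EE, ih]
    rw [← ENNReal.tsum_add]
    exact tsum_congr fun a => by ring

theorem EE_sum {ι : Type*} (s : Finset ι) (n : ℕ) (F : ι → List Ω → ℝ≥0∞) (h : List Ω) :
    EE W n (fun h => ∑ i ∈ s, F i h) h = ∑ i ∈ s, EE W n (F i) h := by
  induction s using Finset.induction_on generalizing h with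
  | empty =>
    simp only [Finset.sum_empty]
    simpa using EE_const_mul W n (fun _ => 0) 0 h
  | insert a s ha ih =>
    simp only [Finset.sum_insert ha]
    rw [EE_add_fun, ih]

theorem EE_tsum {ι : Type*} (n : ℕ) (F : ι → List Ω → ℝ≥0∞) (h : List Ω) :
    EE W n (fun h => ∑' i, F i h) h = ∑' i, EE W n (F i) h := by
  induction n generalizing h with
  | zero => rfl
  | succ n ih =>
    simp only [EE, ih]
    simp_rw [← ENNReal.tsum_mul_left]
    rw [ENNReal.tsum_comm]

theorem EE_const (hW : ∑' a, W a = 1) (n : ℕ) (c : ℝ≥0∞) (h : List Ω) :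
    EE W n (fun _ => c) h = c := by
  induction n generalizing h with
  | zero => rfl
  | succ n ih =>
    simp only [EE, ih]
    rw [ENNReal.tsum_mul_right, hW, one_mul]

/-- symmetrized conditional law -/
def cc {G : Type*} [Group G] (V V' : Ω → G) : List Ω → G → ℝ≥0∞
  | [] => fun g => if g = 1 then 1 else 0
  | a :: h => fun g => (cc V V' h (g * (V a)⁻¹) + cc V V' h (g * (V' a)⁻¹)) / 2

theorem KK_EE {G : Type*} [Group G] (V V' : Ω → G)
    (hσ : ∀ F : G → ℝ≥0∞, ∑' a, W a * F (V' a) = ∑' a, W a * F (V a)) (n : ℕ) (g : G) :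
    KK W V n g = EE W n (fun h => cc V V' h g) [] := by
  induction n generalizing g with
  | zero => simp [KK, EE, cc]
  | succ n ih =>
    rw [EE_add W n 1, KK_right]
    simp only [EE, cc]
    rw [EE_tsum]
    simp_rw [EE_const_mul, div_eq_mul_inv, mul_comm _ (2:ℝ≥0∞)⁻¹, EE_const_mul, EE_add_fun, ← ih]
    simp_rw [mul_left_comm _ (2:ℝ≥0∞)⁻¹]
    rw [ENNReal.tsum_mul_left]
    simp_rw [mul_add]
    rw [ENNReal.tsum_add, hσ (fun v => KK W V n (g * v⁻¹)), ← mul_two, ← mul_assoc, mul_comm,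
      ← mul_assoc, ENNReal.mul_inv_cancel (by simp) (by simp), one_mul]

end

/-- the lamp group `ℤ ≀ ℤ^r` with unrestricted lamps -/
@[ext]
structure Lamp (r : ℕ) where
  x : Fin r → ℤ
  f : (Fin r → ℤ) → ℤ

namespace Lamp
variable {r : ℕ}

instance : Mul (Lamp r) := ⟨fun a b => ⟨a.x + b.x, fun z => a.f z + b.f (z - a.x)⟩⟩
instance : One (Lamp r) := ⟨⟨0, fun _ => 0⟩⟩
instance : Inv (Lamp r) := ⟨fun a => ⟨-a.x, fun z => -a.f (z + a.x)⟩⟩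

@[simp] theorem mul_x (a b : Lamp r) : (a * b).x = a.x + b.x := rfl
@[simp] theorem mul_f (a b : Lamp r) (z) : (a * b).f z = a.f z + b.f (z - a.x) := rfl
@[simp] theorem one_x : (1 : Lamp r).x = 0 := rfl
@[simp] theorem one_f (z) : (1 : Lamp r).f z = 0 := rfl
@[simp] theorem inv_x (a : Lamp r) : (a⁻¹).x = -a.x := rfl
@[simp] theorem inv_f (a : Lamp r) (z) : (a⁻¹).f z = -a.f (z + a.x) := rfl

instance : Group (Lamp r) := Group.ofLeftAxioms
  (by intro a b c; ext <;> simp [add_assoc, sub_sub])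
  (by intro a; ext <;> simp)
  (by intro a; ext <;> simp)

theorem commutator_x (a : Lamp r) (ha : a ∈ commutator (Lamp r)) : a.x = 0 := by
  rw [commutator_eq_closure] at ha
  induction ha using Subgroup.closure_induction with
  | mem x hx => obtain ⟨p, q, rfl⟩ := hx; simp [commutatorElement_def]
  | one => rfl
  | mul a b _ _ ha hb => simp [ha, hb]
  | inv a _ ha => simp [ha]

theorem derived_two : derivedSeries (Lamp r) 2 = ⊥ := by
  rw [derivedSeries_succ, derivedSeries_one, Subgroup.commutator_eq_bot_iff_le_centralizer]
  intro a ha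
  rw [Subgroup.mem_centralizer_iff]
  intro b hb
  have h1 := commutator_x a ha
  have h2 := commutator_x b hb
  ext <;> simp [h1, h2, add_comm]

/-- generators -/
def gen (i0 i1 : Fin r) (i : Fin r) : Lamp r :=
  ⟨ev i 1, fun z => if i = i0 ∧ ∃ t : ℕ, z = ev i1 (t : ℤ) then 1 else 0⟩

theorem gen_diff (i0 i1 : Fin r) (h : i0 ≠ i1) (z) :
    (gen i0 i1 i0 * gen i0 i1 i1).f z = (gen i0 i1 i1 * gen i0 i1 i0).f z
      + if z = 0 then 1 else 0 := by
  simp only [mul_f, gen, h.symm, true_and, false_and, if_false, add_zero, zero_add]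
  by_cases hz : z = 0
  · subst hz
    rw [if_pos ⟨0, by simp [ev]⟩, if_neg, if_pos rfl]
    · norm_num
    rintro ⟨t, ht⟩
    have := congrFun ht i1
    simp [ev] at this
    try omega
  · rw [if_neg hz, add_zero]
    congr 1
    apply propext
    constructor
    · rintro ⟨t, rfl⟩
      rcases t with _ | t
      · exact absurd (by simp [ev]) hz
      · exact ⟨t, by ext k; simp [ev, Pi.single_apply]; split_ifs <;> simp⟩
    · rintro ⟨t, ht⟩
      refine ⟨t + 1, ?_⟩
      rw [sub_eq_iff_eq_add] at ht
      rw [ht]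
      ext k; simp [ev, Pi.single_apply]; split_ifs <;> simp

end Lamp
/-! ## Part F: the binomial bound for the conditional law -/

/-- binomial point masses -/
def Bn : ℕ → ℤ → ℝ≥0∞
  | 0, k => if k = 0 then 1 else 0
  | l + 1, k => (Bn l k + Bn l (k - 1)) / 2

theorem Bn_eq (l : ℕ) (k : ℤ) :
    Bn l k = if k < 0 then 0 else ((l.choose k.toNat : ℕ) : ℝ≥0∞) / 2 ^ l := by
  induction l generalizing k with
  | zero =>
    simp only [Bn]
    rcases lt_trichotomy k 0 with h | h | h
    · simp [h, h.ne]
    · simp [h]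
    · obtain ⟨m, rfl⟩ : ∃ m : ℕ, k = m + 1 := ⟨(k - 1).toNat, by omega⟩
      rw [if_neg (by omega), if_neg (by omega)]
      rw [show ((m:ℤ) + 1).toNat = m + 1 by omega]
      simp
  | succ l ih =>
    simp only [Bn, ih]
    rcases lt_trichotomy k 0 with h | h | h
    · simp [h, show k < 1 by omega]
    · subst h; simp only [lt_irrefl, if_false]
      rw [if_pos (by omega)]
      simp [pow_succ, div_eq_mul_inv, ENNReal.mul_inv]
    · obtain ⟨m, rfl⟩ : ∃ m : ℕ, k = m + 1 := ⟨(k - 1).toNat, by omega⟩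
      rw [if_neg (by omega), if_neg (by omega), if_neg (by omega)]
      rw [show ((m:ℤ) + 1).toNat = m + 1 by omega, show ((m:ℤ) + 1 - 1).toNat = m by omega,
        Nat.choose_succ_succ]
      simp only [pow_succ, div_eq_mul_inv, Nat.cast_add]
      rw [ENNReal.mul_inv (by simp) (by simp)]
      ring

theorem centralBinom_sq (m : ℕ) : m.centralBinom ^ 2 * (2 * m + 1) ≤ 16 ^ m := by
  induction m with
  | zero => simp
  | succ m ih =>
    have h := Nat.succ_mul_centralBinom_succ m
    have h2 : (m + 1) ^ 2 * ((m + 1).centralBinom ^ 2 * (2 * (m + 1) + 1)) ≤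
        (m + 1) ^ 2 * 16 ^ (m + 1) := by
      calc (m + 1) ^ 2 * ((m + 1).centralBinom ^ 2 * (2 * (m + 1) + 1))
          = ((m + 1) * (m + 1).centralBinom) ^ 2 * (2 * m + 3) := by ring
        _ = (m.centralBinom ^ 2 * (2 * m + 1)) * (4 * ((2 * m + 1) * (2 * m + 3))) := by
            rw [h]; ring
        _ ≤ 16 ^ m * (4 * (4 * (m + 1) ^ 2)) := by
            refine Nat.mul_le_mul ih (Nat.mul_le_mul_left _ ?_); nlinarith
        _ = _ := by ring
    exact Nat.le_of_mul_le_mul_left h2 (by positivity)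

theorem choose_sq (l k : ℕ) : (l.choose k) ^ 2 * (l + 1) ≤ (2 ^ l) ^ 2 := by
  have h0 : l.choose k ≤ l.choose (l / 2) := Nat.choose_le_middle k l
  refine le_trans (Nat.mul_le_mul_right _ (Nat.pow_le_pow_left h0 2)) ?_
  rcases Nat.even_or_odd' l with ⟨m, rfl | rfl⟩
  · have := centralBinom_sq m
    rw [show 2 * m / 2 = m by omega]
    rw [Nat.centralBinom] at this
    calc _ ≤ _ := this
      _ = _ := by rw [← pow_mul, mul_right_comm, pow_mul]; norm_num
  · rw [show (2 * m + 1) / 2 = m by omega]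
    have h := centralBinom_sq (m + 1)
    have h1 : (m + 1).centralBinom = 2 * (2 * m + 1).choose m := by
      rw [Nat.centralBinom, show 2 * (m + 1) = (2 * m + 1) + 1 by ring, Nat.choose_succ_succ,
        ← Nat.choose_symm_half m]; ring
    rw [h1] at h
    have h3 : (16:ℕ) ^ (m + 1) = 4 * (2 ^ (2 * m + 1)) ^ 2 := by
      rw [← pow_mul, show (2 * m + 1) * 2 = 4 * m + 2 by ring, show (16:ℕ) = 2 ^ 4 by norm_num,
        ← pow_mul]; ring
    rw [h3] at h
    have : (2 * m + 1).choose m ^ 2 * (2 * m + 1 + 1) ≤ (2 * m + 1).choose m ^ 2 * (2 * (m + 1) + 1) := by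
      gcongr; omega
    nlinarith

/-- `1/√(1+l)` -/
def bet (l : ℕ) : ℝ≥0∞ := ENNReal.ofReal (1 / Real.sqrt (1 + l))

theorem bet_anti {l m : ℕ} (h : l ≤ m) : bet m ≤ bet l := by
  unfold bet
  gcongr

theorem Bn_le (l : ℕ) (k : ℤ) : Bn l k ≤ bet l := by
  rw [Bn_eq]
  split_ifs
  · simp
  · rw [ENNReal.div_le_iff (by simp) (by simp), bet]
    have h2 : (2:ℝ≥0∞) ^ l = ENNReal.ofReal (2 ^ l) := by
      rw [ENNReal.ofReal_pow (by norm_num)]; simp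
    rw [h2, ← ENNReal.ofReal_mul (by positivity), ← ENNReal.ofReal_natCast]
    apply ENNReal.ofReal_le_ofReal
    rw [one_div, inv_mul_eq_div, le_div_iff₀ (by positivity)]
    apply abs_le_of_sq_le_sq' _ (by positivity) |>.2
    rw [mul_pow, Real.sq_sqrt (by positivity)]
    have := choose_sq l k.toNat
    rw [add_comm]
    exact_mod_cast this

section
variable {Ω : Type*} {r : ℕ} (d : Ω → (Fin r → ℤ)) (mk : Ω → Prop)

/-- position -/
def ps : List Ω → (Fin r → ℤ)
  | [] => 0
  | a :: h => ps h + d a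

/-- number of marked visits -/
def lc : List Ω → (Fin r → ℤ) → ℕ
  | [] => fun _ => 0
  | a :: h => fun x => lc h x + if mk a ∧ x = ps d h then 1 else 0

variable (V V' : Ω → Lamp r) (hV : ∀ a, (V a).x = d a) (hV' : ∀ a, (V' a).x = d a)
  (hnm : ∀ a, ¬ mk a → V' a = V a)
  (hm : ∀ a, mk a → (∀ z, (V a).f z = (V' a).f z + if z = 0 then 1 else 0) ∨
    (∀ z, (V' a).f z = (V a).f z + if z = 0 then 1 else 0))

theorem cc_x (V V' : Ω → Lamp r) (hV : ∀ a, (V a).x = d a) (hV' : ∀ a, (V' a).x = d a)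
    (h : List Ω) (g : Lamp r) (hg : cc V V' h g ≠ 0) : g.x = ps d h := by
  induction h generalizing g with
  | nil =>
    simp only [cc] at hg
    by_cases h1 : g = 1
    · rw [h1]; rfl
    · simp [h1] at hg
  | cons a h ih =>
    simp only [cc] at hg
    simp only [ps]
    have : cc V V' h (g * (V a)⁻¹) ≠ 0 ∨ cc V V' h (g * (V' a)⁻¹) ≠ 0 := by
      by_contra hc; push Not at hc; simp [hc.1, hc.2] at hg
    rcases this with h1 | h1
    · have := ih _ h1
      rw [← this]; simp [hV]
    · have := ih _ h1
      rw [← this]; simp [hV']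

theorem prod_half (S : Finset (Fin r → ℤ)) (l : (Fin r → ℤ) → ℕ) (F : (Fin r → ℤ) → ℤ) (y : Fin r → ℤ) :
    (∏ x ∈ S, Bn (l x) (F x) + ∏ x ∈ S, Bn (l x) (F x - if x = y then 1 else 0)) / 2 =
      ∏ x ∈ S, Bn (l x + if x = y then 1 else 0) (F x) := by
  by_cases hy : y ∈ S
  · rw [← Finset.mul_prod_erase S _ hy, ← Finset.mul_prod_erase S _ hy,
      ← Finset.mul_prod_erase S (fun x => Bn (l x + if x = y then 1 else 0) (F x)) hy]
    have h1 : ∏ x ∈ S.erase y, Bn (l x) (F x - if x = y then 1 else 0) = ∏ x ∈ S.erase y, Bn (l x) (F x) :=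
      Finset.prod_congr rfl fun x hx => by rw [if_neg (Finset.ne_of_mem_erase hx), sub_zero]
    have h2 : ∏ x ∈ S.erase y, Bn (l x + if x = y then 1 else 0) (F x) = ∏ x ∈ S.erase y, Bn (l x) (F x) :=
      Finset.prod_congr rfl fun x hx => by rw [if_neg (Finset.ne_of_mem_erase hx), add_zero]
    rw [h1, h2]
    simp only [if_true, Bn]
    rw [← add_mul, ENNReal.mul_div_right_comm]
  · have h1 : ∏ x ∈ S, Bn (l x) (F x - if x = y then 1 else 0) = ∏ x ∈ S, Bn (l x) (F x) :=
      Finset.prod_congr rfl fun x hx => by rw [if_neg (by rintro rfl; exact hy hx), sub_zero]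
    have h2 : ∏ x ∈ S, Bn (l x + if x = y then 1 else 0) (F x) = ∏ x ∈ S, Bn (l x) (F x) :=
      Finset.prod_congr rfl fun x hx => by rw [if_neg (by rintro rfl; exact hy hx), add_zero]
    rw [h1, h2, ENNReal.add_div, ENNReal.add_halves]

theorem cc_prod (V V' : Ω → Lamp r) (hV : ∀ a, (V a).x = d a) (hV' : ∀ a, (V' a).x = d a)
    (hnm : ∀ a, ¬ mk a → V' a = V a)
    (hm : ∀ a, mk a → (∀ z, (V a).f z = (V' a).f z + if z = 0 then 1 else 0) ∨
      (∀ z, (V' a).f z = (V a).f z + if z = 0 then 1 else 0))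
    (S : Finset (Fin r → ℤ)) (h : List Ω) : ∃ D : (Fin r → ℤ) → ℤ, ∀ g : Lamp r,
    cc V V' h g ≤ ∏ x ∈ S, Bn (lc d mk h x) (g.f x - D x) := by
  induction h with
  | nil =>
    refine ⟨fun _ => 0, fun g => ?_⟩
    simp only [cc, lc, Bn]
    split_ifs with h1
    · subst h1; simp
    · simp
  | cons a h ih =>
    obtain ⟨D, hD⟩ := ih
    have key : ∀ (A B : Ω → Lamp r), (∀ a, (A a).x = d a) → (∀ a, (B a).x = d a) → mk a →
        (∀ z, (A a).f z = (B a).f z + if z = 0 then 1 else 0) →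
        ∃ D : (Fin r → ℤ) → ℤ, ∀ g : Lamp r,
        (cc V V' h (g * (B a)⁻¹) + cc V V' h (g * (A a)⁻¹)) / 2 ≤
          ∏ x ∈ S, Bn (lc d mk (a :: h) x) (g.f x - D x) := by
      intro A B hA hB ha hAB
      refine ⟨fun x => D x + (B a).f (x - ps d h), fun g => ?_⟩
      by_cases hg : g.x = ps d h + d a
      · simp only [lc, ha, true_and]
        rw [← prod_half]
        gcongr
        · refine (hD _).trans (le_of_eq ?_)
          refine Finset.prod_congr rfl fun x _ => ?_
          congr 1
          simp only [Lamp.mul_f, Lamp.inv_f, hB, hg]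
          rw [show x - (ps d h + d a) + d a = x - ps d h by abel]; ring
        · refine (hD _).trans (le_of_eq ?_)
          refine Finset.prod_congr rfl fun x _ => ?_
          congr 1
          simp only [Lamp.mul_f, Lamp.inv_f, hA, hg]
          rw [show x - (ps d h + d a) + d a = x - ps d h by abel, hAB]
          simp only [sub_eq_zero]
          ring
      · have hz : ∀ A : Ω → Lamp r, (∀ a, (A a).x = d a) → cc V V' h (g * (A a)⁻¹) = 0 := by
          intro A hA
          by_contra hc
          have := cc_x d V V' hV hV' h _ hc
          apply hg
          rw [← this]; simp [hA]
        rw [hz A hA, hz B hB]; simp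
    by_cases ha : mk a
    · rcases hm a ha with h1 | h1
      · obtain ⟨D', h2⟩ := key V V' hV hV' ha h1
        refine ⟨D', fun g => ?_⟩
        simp only [cc]
        rw [add_comm]
        exact h2 g
      · obtain ⟨D', h2⟩ := key V' V hV' hV ha h1
        exact ⟨D', fun g => h2 g⟩
    · refine ⟨fun x => D x + (V a).f (x - ps d h), fun g => ?_⟩
      simp only [cc, hnm a ha, lc, ha, false_and, if_false, add_zero]
      rw [ENNReal.add_div, ENNReal.add_halves]
      by_cases hg : g.x = ps d h + d a
      · refine (hD _).trans (le_of_eq ?_)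
        refine Finset.prod_congr rfl fun x _ => ?_
        congr 1
        simp only [Lamp.mul_f, Lamp.inv_f, hV, hg]
        rw [show x - (ps d h + d a) + d a = x - ps d h by abel]; ring
      · have : cc V V' h (g * (V a)⁻¹) = 0 := by
          by_contra hc
          have := cc_x d V V' hV hV' h _ hc
          apply hg
          rw [← this]; simp [hV]
        rw [this]; simp

theorem cc_bet (V V' : Ω → Lamp r) (hV : ∀ a, (V a).x = d a) (hV' : ∀ a, (V' a).x = d a)
    (hnm : ∀ a, ¬ mk a → V' a = V a)
    (hm : ∀ a, mk a → (∀ z, (V a).f z = (V' a).f z + if z = 0 then 1 else 0) ∨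
      (∀ z, (V' a).f z = (V a).f z + if z = 0 then 1 else 0))
    (S : Finset (Fin r → ℤ)) (θ : ℕ) (h : List Ω) (g : Lamp r)
    (hS : ∀ x ∈ S, θ ≤ lc d mk h x) : cc V V' h g ≤ bet θ ^ S.card := by
  obtain ⟨D, hD⟩ := cc_prod d mk V V' hV hV' hnm hm S h
  refine (hD g).trans ?_
  rw [← Finset.prod_const]
  exact Finset.prod_le_prod' fun x hx => (Bn_le _ _).trans (bet_anti (hS x hx))

theorem cc_le_one (h : List Ω) (g : Lamp r) : cc V V' h g ≤ 1 := by
  induction h generalizing g with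
  | nil => simp only [cc]; split_ifs <;> simp
  | cons a h ih =>
    simp only [cc]
    refine ENNReal.div_le_of_le_mul ?_
    rw [one_mul, ← one_add_one_eq_two]
    exact add_le_add (ih _) (ih _)

end

/-! ## Part G: few sites carrying most marked visits is unlikely -/

section
variable {Ω : Type*} {r : ℕ} (d : Ω → (Fin r → ℤ)) (mk : Ω → Prop)

/-- positions at the selected times -/
def Hs {k : ℕ} (τ : Fin k → ℕ) (h : List Ω) : Set (Fin r → ℤ) :=
  {x | ∃ s, s <:+ h ∧ ps d s = x ∧ ∃ j, τ j = s.length}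

theorem Hs_finset {k : ℕ} (τ : Fin k → ℕ) (h : List Ω) :
    ∃ H : Finset (Fin r → ℤ), H.card ≤ k ∧ ∀ x ∈ Hs d τ h, x ∈ H := by
  refine ⟨Finset.univ.image (fun j => ps d (h.drop (h.length - τ j))), ?_, ?_⟩
  · exact Finset.card_image_le.trans (by simp)
  · rintro x ⟨s, hs, rfl, j, hj⟩
    rw [Finset.mem_image]
    refine ⟨j, Finset.mem_univ _, ?_⟩
    rw [hj, ← List.suffix_iff_eq_drop.1 hs]

theorem Hs_window {k : ℕ} (τ : Fin k → ℕ) (h h' : List Ω) (hs : h <:+ h')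
    (hτ : ∀ j, ¬ (h.length < τ j ∧ τ j ≤ h'.length)) (x) (hx : x ∈ Hs d τ h') : x ∈ Hs d τ h := by
  obtain ⟨s, h1, h2, j, hj⟩ := hx
  refine ⟨s, ?_, h2, j, hj⟩
  have := hτ j
  have h3 := h1.length_le
  exact List.suffix_of_suffix_length_le h1 hs (by omega)

/-- number of exceptional marked steps -/
def exc (L o : ℕ) {k : ℕ} (τ : Fin k → ℕ) : List Ω → ℕ
  | [] => 0
  | a :: h => exc L o τ h + if h.length % L = o ∧ mk a ∧ ps d h ∉ Hs d τ h then 1 else 0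

theorem exc_mono (L o : ℕ) {k : ℕ} (τ : Fin k → ℕ) (h h' : List Ω) (hs : h <:+ h') :
    exc d mk L o τ h ≤ exc d mk L o τ h' := by
  induction h' with
  | nil => rw [List.suffix_nil.1 hs]
  | cons a h' ih =>
    rcases List.suffix_cons_iff.1 hs with rfl | h1
    · rfl
    · exact (ih h1).trans (by simp [exc])

theorem lc_mono (h h' : List Ω) (hs : h <:+ h') (x) : lc d mk h x ≤ lc d mk h' x := by
  induction h' with
  | nil => rw [List.suffix_nil.1 hs]
  | cons a h' ih =>
    rcases List.suffix_cons_iff.1 hs with rfl | h1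
    · rfl
    · exact (ih h1).trans (by simp [lc])

/-- the exponential functional -/
def Zf (L o : ℕ) {k : ℕ} (τ : Fin k → ℕ) (h : List Ω) : ℝ≥0∞ := (1/4) ^ exc d mk L o τ h

theorem quarter_le : (1/4 : ℝ≥0∞) ≤ 1 := by
  refine ENNReal.div_le_of_le_mul ?_
  norm_num

theorem Zf_anti (L o : ℕ) {k : ℕ} (τ : Fin k → ℕ) (h h' : List Ω) (hs : h <:+ h') :
    Zf d mk L o τ h' ≤ Zf d mk L o τ h :=
  pow_le_pow_right_of_le_one' quarter_le (exc_mono d mk L o τ h h' hs)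

theorem Zf_le_one (L o : ℕ) {k : ℕ} (τ : Fin k → ℕ) (h : List Ω) : Zf d mk L o τ h ≤ 1 :=
  pow_le_one' quarter_le _

theorem Zf_cons (L o : ℕ) {k : ℕ} (τ : Fin k → ℕ) (a : Ω) (h : List Ω) :
    Zf d mk L o τ (a :: h) = Zf d mk L o τ h *
      if h.length % L = o ∧ mk a ∧ ps d h ∉ Hs d τ h then 1/4 else 1 := by
  simp only [Zf, exc, pow_add]
  split_ifs <;> simp

variable (W : Ω → ℝ≥0∞) (hW : ∑' a, W a = 1)

theorem EE_Zf_le (W : Ω → ℝ≥0∞) (hW : ∑' a, W a = 1)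
    (L o : ℕ) {k : ℕ} (τ : Fin k → ℕ) (n : ℕ) (h : List Ω) :
    EE W n (Zf d mk L o τ) h ≤ Zf d mk L o τ h := by
  refine (EE_mono W n _ (fun _ => Zf d mk L o τ h) h fun h' _ hs => Zf_anti d mk L o τ h h' hs).trans ?_
  rw [EE_const W hW]

variable (T k : ℕ) (hsp : ∀ H : Finset (Fin r → ℤ), H.card ≤ k → ∀ h : List Ω,
    EE W T (fun h' => if ps d h' ∈ H then 1 else 0) h ≤ 1/4)
  (η ηc : ℝ≥0∞) (hη : η = ∑' a, W a * if mk a then 1 else 0)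
  (hηc : ηc = ∑' a, W a * if mk a then 0 else 1)

theorem window (W : Ω → ℝ≥0∞) (hW : ∑' a, W a = 1)
    (T k : ℕ) (hsp : ∀ H : Finset (Fin r → ℤ), H.card ≤ k → ∀ h : List Ω,
      EE W T (fun h' => if ps d h' ∈ H then 1 else 0) h ≤ 1/4)
    (η ηc : ℝ≥0∞) (hη : η = ∑' a, W a * if mk a then 1 else 0)
    (hηc : ηc = ∑' a, W a * if mk a then 0 else 1)
    (o : ℕ) (τ : Fin k → ℕ) (h : List Ω) (ho : (h.length + T) % (T + 1) = o) :
    EE W (T + 1) (Zf d mk (T+1) o τ) h ≤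
      (if ∃ j, h.length < τ j ∧ τ j ≤ h.length + T then 1 else ηc + η * (1/2)) *
        Zf d mk (T+1) o τ h := by
  split_ifs with hc
  · rw [one_mul]; exact EE_Zf_le d mk W hW _ _ _ _ _
  · push Not at hc
    rw [EE_add W T 1]
    obtain ⟨H, hHk, hH⟩ := Hs_finset d τ h
    have h1 : EE W T (EE W 1 (Zf d mk (T+1) o τ)) h ≤
        EE W T (fun h' => Zf d mk (T+1) o τ h * ((ηc + η * (1/4)) +
          η * (if ps d h' ∈ H then 1 else 0))) h := by
      refine EE_mono W T _ _ h fun h' hl hs => ?_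
      simp only [EE]
      simp_rw [Zf_cons]
      have hlen : h'.length % (T + 1) = o := by rw [hl, add_comm]; exact ho
      calc ∑' a, W a * (Zf d mk (T+1) o τ h' *
            if h'.length % (T+1) = o ∧ mk a ∧ ps d h' ∉ Hs d τ h' then 1/4 else 1)
          ≤ ∑' a, Zf d mk (T+1) o τ h * (W a * (if mk a then 0 else 1) +
            (W a * (if mk a then 1 else 0)) * (1/4 + if ps d h' ∈ H then 1 else 0)) := by
              refine ENNReal.tsum_le_tsum fun a => ?_
              rw [mul_left_comm]
              refine mul_le_mul' (Zf_anti d mk _ _ _ _ _ hs) ?_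
              simp only [hlen, true_and]
              by_cases ha : mk a
              · simp only [ha, true_and, if_true, mul_zero, zero_add, mul_one]
                gcongr
                by_cases hx : ps d h' ∈ Hs d τ h'
                · have : ps d h' ∈ H := hH _ (Hs_window d τ h h' hs (by
                    intro j hj
                    have := hc j hj.1
                    omega) _ hx)
                  simp [hx, this]
                · simp [hx]
              · simp [ha]
        _ = _ := by
            rw [ENNReal.tsum_mul_left, ENNReal.tsum_add, ENNReal.tsum_mul_right, ← hη, ← hηc]
            ring
    refine h1.trans ?_
    rw [EE_const_mul, EE_add_fun, EE_const W hW, EE_const_mul, mul_comm,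
      add_assoc, ← mul_add]
    refine mul_le_mul_left (add_le_add_right (mul_le_mul_right ?_ _) _) _
    refine (add_le_add_right (hsp H hHk h) _).trans (le_of_eq ?_)
    rw [ENNReal.div_add_div_same, one_add_one_eq_two, ENNReal.div_eq_div_iff] <;> norm_num

theorem windows (W : Ω → ℝ≥0∞) (hW : ∑' a, W a = 1)
    (T k : ℕ) (hsp : ∀ H : Finset (Fin r → ℤ), H.card ≤ k → ∀ h : List Ω,
      EE W T (fun h' => if ps d h' ∈ H then 1 else 0) h ≤ 1/4)
    (η ηc : ℝ≥0∞) (hη : η = ∑' a, W a * if mk a then 1 else 0)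
    (hηc : ηc = ∑' a, W a * if mk a then 0 else 1)
    (o : ℕ) (τ : Fin k → ℕ) (q : ℕ) (h : List Ω) (ho : (h.length + T) % (T + 1) = o) :
    EE W ((T + 1) * q) (Zf d mk (T+1) o τ) h ≤
      (∏ i ∈ Finset.range q, if ∃ j, h.length + (T+1) * i < τ j ∧ τ j ≤ h.length + (T+1) * i + T
        then 1 else ηc + η * (1/2)) * Zf d mk (T+1) o τ h := by
  induction q with
  | zero => simp [EE]
  | succ q ih =>
    rw [mul_add, mul_one, EE_add]
    refine (EE_mono W _ _ (fun h' => (if ∃ j, h.length + (T+1) * q < τ j ∧ τ j ≤ h.length + (T+1) * q + T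
        then 1 else ηc + η * (1/2)) * Zf d mk (T+1) o τ h') h fun h' hl hs => ?_).trans ?_
    · have := window d mk W hW T k hsp η ηc hη hηc o τ h' (by
        rw [hl, ← ho, add_assoc, Nat.mul_add_mod])
      rw [hl, add_comm _ h.length] at this
      exact this
    · rw [EE_const_mul, Finset.prod_range_succ, mul_comm (∏ i ∈ Finset.range q, _), mul_assoc]
      gcongr

theorem prod_windows (τ : Fin k → ℕ) (q m : ℕ) (ρ : ℝ≥0∞) (hρ : ρ ≤ 1) :
    (∏ i ∈ Finset.range q, if ∃ j, m + (T+1) * i < τ j ∧ τ j ≤ m + (T+1) * i + T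
        then 1 else ρ) ≤ ρ ^ (q - k) := by
  rw [Finset.prod_ite, Finset.prod_const_one, one_mul, Finset.prod_const]
  apply pow_le_pow_right_of_le_one' hρ
  have h1 := Finset.card_filter_add_card_filter_not (s := Finset.range q)
    (fun i => ∃ j, m + (T+1) * i < τ j ∧ τ j ≤ m + (T+1) * i + T)
  have h2 : ((Finset.range q).filter
      (fun i => ∃ j, m + (T+1) * i < τ j ∧ τ j ≤ m + (T+1) * i + T)).card ≤ k := by
    calc _ ≤ (Finset.univ.image (fun j => (τ j - (m + 1)) / (T+1))).card := by
          apply Finset.card_le_card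
          intro i hi
          obtain ⟨-, j, h3, h4⟩ := Finset.mem_filter.1 hi
          rw [Finset.mem_image]
          refine ⟨j, Finset.mem_univ _, ?_⟩
          rw [Nat.div_eq_iff (by omega)]
          rw [mul_comm i]
          omega
      _ ≤ k := Finset.card_image_le.trans (by simp)
  rw [Finset.card_range] at h1
  omega

theorem EE_Zf_total (W : Ω → ℝ≥0∞) (hW : ∑' a, W a = 1)
    (T k : ℕ) (hsp : ∀ H : Finset (Fin r → ℤ), H.card ≤ k → ∀ h : List Ω,
      EE W T (fun h' => if ps d h' ∈ H then 1 else 0) h ≤ 1/4)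
    (η ηc : ℝ≥0∞) (hη : η = ∑' a, W a * if mk a then 1 else 0)
    (hηc : ηc = ∑' a, W a * if mk a then 0 else 1)
    (o : ℕ) (ho : o < T + 1) (τ : Fin k → ℕ) (q : ℕ) :
    EE W ((T + 1) * (q + 1)) (Zf d mk (T+1) o τ) [] ≤ (ηc + η * (1/2)) ^ (q - k) := by
  have hρ : ηc + η * (1/2) ≤ 1 := by
    calc ηc + η * (1/2) ≤ ηc + η * 1 := by gcongr; simp
      _ = 1 := by
        rw [hη, hηc, mul_one, ← ENNReal.tsum_add]
        refine Eq.trans ?_ hW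
        exact tsum_congr fun a => by split_ifs <;> simp
  rw [show (T + 1) * (q + 1) = (o + 1) + ((T + 1) * q + (T - o)) by rw [mul_add]; omega, EE_add]
  refine (EE_mono W _ _ (fun _ => (ηc + η * (1/2)) ^ (q - k)) [] fun h hl _ => ?_).trans
    (by rw [EE_const W hW])
  rw [EE_add]
  refine (EE_mono W _ _ _ h fun h' _ _ => EE_Zf_le d mk W hW _ _ _ _ _).trans ?_
  refine (windows d mk W hW T k hsp η ηc hη hηc o τ q h ?_).trans ?_
  · rw [hl]
    simp only [List.length_nil, add_zero]
    rw [show o + 1 + T = o + (T + 1) by ring, Nat.add_mod_right, Nat.mod_eq_of_lt ho]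
  · calc _ ≤ (ηc + η * (1/2)) ^ (q - k) * 1 :=
          mul_le_mul' (prod_windows T k τ q _ _ hρ) (Zf_le_one _ _ _ _ _ _)
      _ = _ := mul_one _

theorem exc_sum (L : ℕ) (hL : 0 < L) (τ : Fin k → ℕ) (A : Finset (Fin r → ℤ)) (h : List Ω)
    (hA : ∀ a s, (a :: s) <:+ h → mk a → ps d s ∉ Hs d τ s → ps d s ∈ A) :
    ∑ o ∈ Finset.range L, exc d mk L o τ h ≤ ∑ x ∈ A, lc d mk h x := by
  induction h with
  | nil => simp [exc]
  | cons a h ih =>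
    have h1 := ih fun b s hs => hA b s (hs.trans (List.suffix_cons _ _))
    simp only [exc, lc, Finset.sum_add_distrib]
    refine add_le_add h1 ?_
    by_cases hc : mk a ∧ ps d h ∉ Hs d τ h
    · have h2 := hA a h (List.suffix_refl _) hc.1 hc.2
      simp only [hc.1, hc.2, not_false_eq_true, and_true, true_and]
      rw [Finset.sum_ite_eq, Finset.sum_ite_eq']
      simp [h2, Nat.mod_lt _ hL]
    · simp only [hc, and_false, if_false, Finset.sum_const_zero]
      exact Nat.zero_le _

theorem exists_tau (N : ℕ) (h : List Ω) (hN : h.length = N) (Hv : Finset (Fin r → ℤ))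
    (hk : Hv.card ≤ k) : ∃ τ : Fin k → Fin (N + 1), ∀ s, s <:+ h → ps d s ∈ Hv →
      ps d s ∈ Hs d (fun j => (τ j : ℕ)) s := by
  have hex : ∀ x : Fin r → ℤ, ∃ t : Fin (N + 1), ∀ s, s <:+ h → ps d s = x →
      ∃ s', s' <:+ s ∧ ps d s' = x ∧ (t:ℕ) = s'.length := by
    intro x
    by_cases hx : ∃ n, ∃ s, s <:+ h ∧ ps d s = x ∧ s.length = n
    · obtain ⟨s', h1, h2, h3⟩ := Nat.find_spec hx
      refine ⟨⟨Nat.find hx, ?_⟩, fun s hs hsx => ⟨s', ?_, h2, h3.symm⟩⟩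
      · have := h1.length_le; omega
      · apply List.suffix_of_suffix_length_le h1 hs
        rw [h3]
        exact Nat.find_min' hx ⟨s, hs, hsx, rfl⟩
    · exact ⟨0, fun s hs hsx => absurd ⟨_, s, hs, hsx, rfl⟩ hx⟩
  choose t ht using hex
  refine ⟨fun j => if hj : (j:ℕ) < Hv.card then t (Hv.equivFin.symm ⟨j, hj⟩) else 0, ?_⟩
  intro s hs hx
  obtain ⟨s', h1, h2, h3⟩ := ht _ s hs rfl
  refine ⟨s', h1, h2, ⟨Hv.equivFin ⟨ps d s, hx⟩, ?_⟩, ?_⟩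
  · exact lt_of_lt_of_le (Fin.is_lt _) hk
  · simp [h3]

theorem lc_finite (h : List Ω) : {x | 1 ≤ lc d mk h x}.Finite := by
  induction h with
  | nil => simp [lc]
  | cons a h ih =>
    refine (ih.union (Set.finite_singleton (ps d h))).subset fun x hx => ?_
    simp only [lc, Set.mem_ofPred_eq] at hx
    by_cases hxp : x = ps d h
    · right; exact hxp
    · left; simpa [hxp] using hx

theorem exists_good (N L θ D0 M : ℕ) (hL : 0 < L) (h : List Ω) (hN : h.length = N)
    (Hv A : Finset (Fin r → ℤ)) (hk : Hv.card ≤ k) (hAD : A.card ≤ D0)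
    (hAθ : ∀ x ∈ A, lc d mk h x ≤ θ) (hvis : ∀ x, 1 ≤ lc d mk h x → x ∈ Hv ∨ x ∈ A)
    (hM : θ * D0 ≤ L * M) : ∃ τ : Fin k → Fin (N + 1), ∃ o ∈ Finset.range L,
      (1/4) ^ M ≤ Zf d mk L o (fun j => (τ j : ℕ)) h := by
  obtain ⟨τ, hτ⟩ := exists_tau d k N h hN Hv hk
  have h1 := exc_sum d mk k L hL (fun j => (τ j : ℕ)) A h (by
    intro a s hs ha hn
    have hs' : s <:+ h := (List.suffix_cons _ _).trans hs
    have h2 : 1 ≤ lc d mk h (ps d s) := by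
      refine le_trans ?_ (lc_mono d mk (a :: s) h hs _)
      simp [lc, ha]
    rcases hvis _ h2 with h3 | h3
    · exact absurd (hτ s hs' h3) hn
    · exact h3)
  have h2 : ∑ x ∈ A, lc d mk h x ≤ θ * D0 := by
    calc _ ≤ ∑ x ∈ A, θ := Finset.sum_le_sum hAθ
      _ = A.card * θ := by simp
      _ ≤ D0 * θ := by gcongr
      _ = _ := mul_comm _ _
  obtain ⟨o, ho, h3⟩ := Finset.exists_le_of_sum_le (s := Finset.range L)
    (f := fun o => exc d mk L o (fun j => (τ j : ℕ)) h) (g := fun _ => M) ⟨0, by simpa using hL⟩ (by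
      simp only [Finset.sum_const, Finset.card_range, smul_eq_mul]; omega)
  exact ⟨τ, o, ho, pow_le_pow_right_of_le_one' quarter_le h3⟩

variable (V V' : Ω → Lamp r) (hV : ∀ a, (V a).x = d a) (hV' : ∀ a, (V' a).x = d a)
  (hnm : ∀ a, ¬ mk a → V' a = V a)
  (hm : ∀ a, mk a → (∀ z, (V a).f z = (V' a).f z + if z = 0 then 1 else 0) ∨
    (∀ z, (V' a).f z = (V a).f z + if z = 0 then 1 else 0))

theorem bet_le_one (l : ℕ) : bet l ≤ 1 := by
  refine (bet_anti (Nat.zero_le l)).trans ?_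
  simp [bet]

theorem EE_upper (W : Ω → ℝ≥0∞) (hW : ∑' a, W a = 1)
    (T k : ℕ) (hsp : ∀ H : Finset (Fin r → ℤ), H.card ≤ k → ∀ h : List Ω,
      EE W T (fun h' => if ps d h' ∈ H then 1 else 0) h ≤ 1/4)
    (η ηc : ℝ≥0∞) (hη : η = ∑' a, W a * if mk a then 1 else 0)
    (hηc : ηc = ∑' a, W a * if mk a then 0 else 1)
    (V V' : Ω → Lamp r) (hV : ∀ a, (V a).x = d a) (hV' : ∀ a, (V' a).x = d a)
    (hnm : ∀ a, ¬ mk a → V' a = V a)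
    (hm : ∀ a, mk a → (∀ z, (V a).f z = (V' a).f z + if z = 0 then 1 else 0) ∨
      (∀ z, (V' a).f z = (V a).f z + if z = 0 then 1 else 0))
    (q θ D0 M : ℕ) (hθ : 1 ≤ θ) (hM : θ * D0 ≤ (T + 1) * M) (g : Lamp r) :
    EE W ((T + 1) * (q + 1)) (fun h => cc V V' h g) [] ≤
      bet θ ^ k + bet 1 ^ D0 + (((T + 1) * (q + 1) + 1 : ℕ) : ℝ≥0∞) ^ k * (T + 1 : ℕ) * 4 ^ M *
        (ηc + η * (1/2)) ^ (q - k) := by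
  set N := (T + 1) * (q + 1) with hN
  have hpt : ∀ h : List Ω, h.length = N → cc V V' h g ≤
      (bet θ ^ k + bet 1 ^ D0) + 4 ^ M * ∑ τ : Fin k → Fin (N + 1), ∑ o ∈ Finset.range (T + 1),
        Zf d mk (T + 1) o (fun j => (τ j : ℕ)) h := by
    intro h hh
    set Vs := (lc_finite d mk h).toFinset with hVs
    have hmem : ∀ x, x ∈ Vs ↔ 1 ≤ lc d mk h x := by intro x; simp [hVs]
    by_cases c1 : k ≤ (Vs.filter (fun x => θ ≤ lc d mk h x)).card
    · refine le_trans (cc_bet d mk V V' hV hV' hnm hm (Vs.filter (fun x => θ ≤ lc d mk h x)) θ h g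
        (fun x hx => (Finset.mem_filter.1 hx).2)) ?_
      refine (pow_le_pow_right_of_le_one' (bet_le_one _) c1).trans ?_
      rw [add_assoc]; exact le_self_add
    by_cases c2 : D0 ≤ Vs.card
    · refine le_trans (cc_bet d mk V V' hV hV' hnm hm Vs 1 h g (fun x hx => (hmem x).1 hx)) ?_
      refine (pow_le_pow_right_of_le_one' (bet_le_one _) c2).trans ?_
      rw [add_right_comm]; exact le_add_self
    obtain ⟨τ, o, ho, h1⟩ := exists_good d mk k N (T+1) θ D0 M (by omega) h hh
      (Vs.filter (fun x => θ ≤ lc d mk h x)) (Vs.filter (fun x => ¬ θ ≤ lc d mk h x)) (by omega)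
      ((Finset.card_filter_le _ _).trans (by omega))
      (fun x hx => by have := (Finset.mem_filter.1 hx).2; omega)
      (fun x hx => by
        rw [Finset.mem_filter, Finset.mem_filter, hmem]
        tauto) hM
    refine (cc_le_one V V' h g).trans (le_trans ?_ le_add_self)
    calc (1:ℝ≥0∞) = 4 ^ M * (1/4) ^ M := by
          rw [← mul_pow, one_div, ENNReal.mul_inv_cancel (by simp) (by simp), one_pow]
      _ ≤ _ := by
          gcongr
          refine h1.trans ?_
          refine le_trans ?_ (Finset.single_le_sum (f := fun τ : Fin k → Fin (N+1) =>
            ∑ o ∈ Finset.range (T + 1), Zf d mk (T + 1) o (fun j => (τ j : ℕ)) h)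
            (fun _ _ => zero_le) (Finset.mem_univ τ))
          exact Finset.single_le_sum (f := fun o => Zf d mk (T + 1) o (fun j => (τ j : ℕ)) h)
            (fun _ _ => zero_le) ho
  refine (EE_mono W N _ _ [] fun h hl _ => hpt h (by simpa using hl)).trans ?_
  rw [EE_add_fun, EE_const W hW, EE_const_mul, EE_sum]
  refine add_le_add_right ?_ _
  calc _ ≤ 4 ^ M * ∑ τ : Fin k → Fin (N + 1), ∑ o ∈ Finset.range (T + 1),
        (ηc + η * (1/2)) ^ (q - k) := by
        gcongr with τ
        rw [EE_sum]
        exact Finset.sum_le_sum fun o ho => EE_Zf_total d mk W hW T k hsp η ηc hη hηc o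
          (Finset.mem_range.1 ho) _ q
    _ = _ := by
        simp only [Finset.sum_const, Finset.card_range, Finset.card_univ, Fintype.card_pi,
          Fintype.card_fin, nsmul_eq_mul, Finset.prod_const]
        push_cast
        ring

end

/-! ## Part H: spreading of the heavy-tailed walk on `ℤ^r` -/

/-- averaging operator -/
def Av {r : ℕ} {Ω : Type*} (w : Ω → ℝ≥0∞) (d : Ω → (Fin r → ℤ)) (f : (Fin r → ℤ) → ℝ≥0∞)
    (x : Fin r → ℤ) : ℝ≥0∞ := ∑' ω, w ω * f (x + d ω)

section
variable {r : ℕ} {Ω Ω' : Type*}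

theorem Av_comm (w : Ω → ℝ≥0∞) (d : Ω → (Fin r → ℤ)) (u : Ω' → ℝ≥0∞) (e : Ω' → (Fin r → ℤ)) :
    Function.Commute (Av w d) (Av u e) := by
  intro f
  funext x
  simp only [Av, ← ENNReal.tsum_mul_left]
  rw [ENNReal.tsum_comm]
  refine tsum_congr fun a => tsum_congr fun b => ?_
  rw [add_right_comm]; ring

theorem Av_le (w : Ω → ℝ≥0∞) (d : Ω → (Fin r → ℤ)) (hw : ∑' a, w a = 1)
    (f : (Fin r → ℤ) → ℝ≥0∞) (s : ℝ≥0∞) (hf : ∀ x, f x ≤ s) (x) : Av w d f x ≤ s := by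
  calc Av w d f x ≤ ∑' a, w a * s := ENNReal.tsum_le_tsum fun a => by gcongr; exact hf _
    _ = s := by rw [ENNReal.tsum_mul_right, hw, one_mul]

theorem Av_iter_le (w : Ω → ℝ≥0∞) (d : Ω → (Fin r → ℤ)) (hw : ∑' a, w a = 1)
    (f : (Fin r → ℤ) → ℝ≥0∞) (s : ℝ≥0∞) (hf : ∀ x, f x ≤ s) (t : ℕ) (x) : (Av w d)^[t] f x ≤ s := by
  induction t generalizing x with
  | zero => exact hf x
  | succ t ih =>
    rw [Function.iterate_succ_apply']
    exact Av_le w d hw _ s ih x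

theorem Av_one_step (w : Ω → ℝ≥0∞) (d : Ω → (Fin r → ℤ)) (hw : ∑' a, w a = 1)
    (u : Ω' → ℝ≥0∞) (e : Ω' → (Fin r → ℤ)) (b : ℝ≥0∞) (hb : b ≤ 1)
    (hdom : ∀ g : (Fin r → ℤ) → ℝ≥0∞, ∀ s x, (∀ y, g y ≤ s) →
      Av w d g x ≤ b * Av u e g x + (1 - b) * s)
    (f : (Fin r → ℤ) → ℝ≥0∞) (hf : ∀ x, f x ≤ 1) (S : ℝ≥0∞) (hS : ∀ x, Av u e f x ≤ S) (t : ℕ) (x) :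
    (Av w d)^[t] f x ≤ (1 - b) ^ t + S := by
  induction t generalizing x with
  | zero => simp only [Function.iterate_zero, id, pow_zero]; exact (hf x).trans le_self_add
  | succ t ih =>
    rw [Function.iterate_succ_apply']
    refine (hdom _ _ x ih).trans ?_
    have h1 : Av u e ((Av w d)^[t] f) x ≤ S := by
      rw [((Av_comm u e w d).iterate_right t) f]
      exact Av_iter_le w d hw _ S hS t x
    calc _ ≤ b * S + (1 - b) * ((1 - b) ^ t + S) := by gcongr
      _ = (1 - b) ^ (t + 1) + (b + (1 - b)) * S := by ring
      _ = _ := by rw [add_tsub_cancel_of_le hb, one_mul]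

/-- uniform weights on an interval -/
def unif (L : ℕ) (m : ℤ) : ℝ≥0∞ :=
  if m ∈ Finset.Icc (-(L:ℤ)) L then ((2 * L + 1 : ℕ) : ℝ≥0∞)⁻¹ else 0

theorem unif_sum (L : ℕ) : ∑' m, unif L m = 1 := by
  rw [tsum_eq_sum (s := Finset.Icc (-(L:ℤ)) L) (fun m hm => by simp only [unif]; rw [if_neg hm])]
  rw [Finset.sum_congr rfl (g := fun _ => ((2 * L + 1 : ℕ) : ℝ≥0∞)⁻¹) (fun m hm => by
    simp only [unif]; rw [if_pos hm])]
  rw [Finset.sum_const, Int.card_Icc, show ((L:ℤ) + 1 - -(L:ℤ)).toNat = 2 * L + 1 by omega,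
    nsmul_eq_mul, ENNReal.mul_inv_cancel (by simp) (ENNReal.natCast_ne_top _)]

/-- averaging in direction `i` -/
def Ui (L : Fin r → ℕ) (i : Fin r) : ((Fin r → ℤ) → ℝ≥0∞) → (Fin r → ℤ) → ℝ≥0∞ :=
  Av (unif (L i)) (fun m => ev i m)

variable (w : Fin r × ℤ → ℝ≥0∞) (hw : ∑' p, w p = 1) (L : Fin r → ℕ) (b : Fin r → ℝ≥0∞)
  (hb : ∀ i m, b i * unif (L i) m ≤ w (i, m))

theorem single_sum (i : Fin r) (F : Fin r × ℤ → ℝ≥0∞) :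
    ∑' p : Fin r × ℤ, (if p.1 = i then F p else 0) = ∑' m, F (i, m) := by
  rw [ENNReal.tsum_prod', tsum_fintype, Finset.sum_eq_single i]
  · simp
  · intro j _ hj; simp [hj]
  · simp

theorem b_le_one (w : Fin r × ℤ → ℝ≥0∞) (hw : ∑' p, w p = 1) (L : Fin r → ℕ) (b : Fin r → ℝ≥0∞)
    (hb : ∀ i m, b i * unif (L i) m ≤ w (i, m))
    (i : Fin r) : b i ≤ 1 := by
  calc b i = ∑' m, b i * unif (L i) m := by rw [ENNReal.tsum_mul_left, unif_sum, mul_one]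
    _ ≤ ∑' m, w (i, m) := ENNReal.tsum_le_tsum (hb i)
    _ = ∑' p : Fin r × ℤ, (if p.1 = i then w p else 0) := (single_sum i w).symm
    _ ≤ ∑' p, w p := ENNReal.tsum_le_tsum fun p => by split_ifs <;> simp
    _ = 1 := hw

theorem dom (w : Fin r × ℤ → ℝ≥0∞) (hw : ∑' p, w p = 1) (L : Fin r → ℕ) (b : Fin r → ℝ≥0∞)
    (hb : ∀ i m, b i * unif (L i) m ≤ w (i, m))
    (i : Fin r) (g : (Fin r → ℤ) → ℝ≥0∞) (s : ℝ≥0∞) (x) (hg : ∀ y, g y ≤ s) :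
    Av w (fun p => ev p.1 p.2) g x ≤ b i * Ui L i g x + (1 - b i) * s := by
  set w' : Fin r × ℤ → ℝ≥0∞ := fun p => if p.1 = i then b i * unif (L i) p.2 else 0 with hw'
  have hle : ∀ p, w' p ≤ w p := by
    intro ⟨j, m⟩
    simp only [hw']
    split_ifs with h
    · rw [h]; exact hb i m
    · simp
  have hs : ∑' p, w' p = b i := by
    rw [hw', single_sum i (fun p => b i * unif (L i) p.2), ENNReal.tsum_mul_left, unif_sum, mul_one]
  have hdiff : ∑' p, (w p - w' p) = 1 - b i := by
    refine ENNReal.eq_sub_of_add_eq (ne_top_of_le_ne_top (by simp) (b_le_one w hw L b hb i)) ?_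
    rw [← hs, ← ENNReal.tsum_add, ← hw]
    exact tsum_congr fun p => tsub_add_cancel_of_le (hle p)
  calc Av w (fun p => ev p.1 p.2) g x
      = ∑' p : Fin r × ℤ, (w' p * g (x + ev p.1 p.2) + (w p - w' p) * g (x + ev p.1 p.2)) := by
        refine tsum_congr fun p => ?_
        rw [← add_mul, add_tsub_cancel_of_le (hle p)]
    _ ≤ ∑' p : Fin r × ℤ, (w' p * g (x + ev p.1 p.2) + (w p - w' p) * s) := by
        refine ENNReal.tsum_le_tsum fun p => ?_
        gcongr
        exact hg _
    _ = _ := by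
        rw [ENNReal.tsum_add, ENNReal.tsum_mul_right, hdiff]
        congr 1
        simp only [hw', ite_mul, zero_mul]
        rw [single_sum i (fun p => b i * unif (L i) p.2 * g (x + ev p.1 p.2)), Ui, Av,
          ← ENNReal.tsum_mul_left]
        exact tsum_congr fun m => by ring

/-- averaging along a list of directions -/
def Ul (L : Fin r → ℕ) (l : List (Fin r)) (f : (Fin r → ℤ) → ℝ≥0∞) : (Fin r → ℤ) → ℝ≥0∞ :=
  l.foldr (fun i f => Ui L i f) f

theorem Ul_comm (w : Fin r × ℤ → ℝ≥0∞) (L : Fin r → ℕ) (l : List (Fin r)) :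
    Function.Commute (Ul L l) (Av w (fun p => ev p.1 p.2)) := by
  induction l with
  | nil => intro f; rfl
  | cons i l ih =>
    intro f
    have h1 := ih f
    change Ui L i (Ul L l _) = Av w _ (Ui L i (Ul L l f))
    rw [h1]
    exact Av_comm _ _ _ _ _

theorem Ul_le_one (l : List (Fin r)) (f : (Fin r → ℤ) → ℝ≥0∞) (hf : ∀ x, f x ≤ 1) (x) :
    Ul L l f x ≤ 1 := by
  induction l generalizing x with
  | nil => exact hf x
  | cons i l ih => exact Av_le _ _ (unif_sum _) _ 1 ih x

theorem Ul_iter (w : Fin r × ℤ → ℝ≥0∞) (hw : ∑' p, w p = 1) (L : Fin r → ℕ) (b : Fin r → ℝ≥0∞)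
    (hb : ∀ i m, b i * unif (L i) m ≤ w (i, m))
    (l : List (Fin r)) (t : ℕ) (f : (Fin r → ℤ) → ℝ≥0∞) (hf : ∀ x, f x ≤ 1) (S : ℝ≥0∞)
    (hS : ∀ x, Ul L l f x ≤ S) (x) :
    (Av w (fun p => ev p.1 p.2))^[t * l.length] f x ≤ (l.map fun i => (1 - b i) ^ t).sum + S := by
  induction l generalizing f S x with
  | nil => simpa [Ul] using hS x
  | cons i l ih =>
    rw [List.length_cons, mul_add, mul_one, Function.iterate_add_apply, List.map_cons, List.sum_cons,
      add_comm ((1 - b i) ^ t), add_assoc]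
    apply ih
    · exact Av_iter_le w _ hw f 1 hf t
    · intro y
      rw [((Ul_comm w L l).iterate_right t) f]
      exact Av_one_step w _ hw (unif (L i)) (fun m => ev i m) (b i) (b_le_one w hw L b hb i)
        (fun g s x hg => dom w hw L b hb i g s x hg) _ (Ul_le_one L l f hf) S hS t y

theorem Ul_ind (H : Finset (Fin r → ℤ)) (l : List (Fin r)) (hl : l.Nodup) (x : Fin r → ℤ) :
    Ul L l (fun x => if x ∈ H then 1 else 0) x ≤
      (l.map fun i => ((2 * L i + 1 : ℕ) : ℝ≥0∞)⁻¹).prod *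
        ∑ y ∈ H, if ∀ j, j ∉ l → x j = y j then 1 else 0 := by
  induction l generalizing x with
  | nil =>
    simp only [Ul, List.foldr_nil, List.map_nil, List.prod_nil, one_mul]
    split_ifs with hx
    · refine le_trans ?_ (Finset.single_le_sum (f := fun y => if ∀ j, j ∉ [] → x j = y j then (1:ℝ≥0∞) else 0)
        (fun _ _ => zero_le) hx)
      simp
    · simp
  | cons i l ih =>
    rw [List.nodup_cons] at hl
    change Ui L i (Ul L l _) x ≤ _
    simp only [Ui, Av]
    set p := (l.map fun i => ((2 * L i + 1 : ℕ) : ℝ≥0∞)⁻¹).prod with hp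
    set u := ((2 * L i + 1 : ℕ) : ℝ≥0∞)⁻¹ with hu
    rw [List.map_cons, List.prod_cons, ← hu, ← hp]
    calc _ ≤ ∑' m : ℤ, u * (p * ∑ y ∈ H, if ∀ j, j ∉ l → (x + ev i m) j = y j then 1 else 0) := by
          refine ENNReal.tsum_le_tsum fun m => mul_le_mul' ?_ (ih hl.2 _)
          rw [unif]; split_ifs <;> simp [hu]
      _ = u * p * ∑ y ∈ H, ∑' m : ℤ, if ∀ j, j ∉ l → (x + ev i m) j = y j then 1 else 0 := by
          rw [ENNReal.tsum_mul_left, ENNReal.tsum_mul_left, mul_assoc]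
          congr 2
          exact Summable.tsum_finsetSum fun _ _ => ENNReal.summable
      _ ≤ _ := by
          gcongr with y hy
          rw [tsum_eq_single (y i - x i)]
          · split_ifs with h1 h2 h2
            · exact le_rfl
            · exfalso; apply h2
              intro j hj
              rw [List.mem_cons, not_or] at hj
              have := h1 j hj.2
              simpa [ev, Pi.single_apply, hj.1] using this
            · simp
            · simp
          · intro m hm
            rw [if_neg]
            intro h
            have := h i hl.1
            simp [ev] at this
            omega

theorem spread (w : Fin r × ℤ → ℝ≥0∞) (hw : ∑' p, w p = 1) (L : Fin r → ℕ) (b : Fin r → ℝ≥0∞)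
    (hb : ∀ i m, b i * unif (L i) m ≤ w (i, m))
    (H : Finset (Fin r → ℤ)) (t : ℕ) (x) :
    (Av w (fun p => ev p.1 p.2))^[t * r] (fun x => if x ∈ H then 1 else 0) x ≤
      ∑ i, (1 - b i) ^ t + (∏ i, ((2 * L i + 1 : ℕ) : ℝ≥0∞)⁻¹) * H.card := by
  have := Ul_iter w hw L b hb (Finset.univ.toList) t (fun x => if x ∈ H then 1 else 0)
    (fun x => by split_ifs <;> simp) ((∏ i, ((2 * L i + 1 : ℕ) : ℝ≥0∞)⁻¹) * H.card) (fun y => by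
      refine (Ul_ind L H _ (Finset.nodup_toList _) y).trans ?_
      rw [Finset.prod_map_toList]
      gcongr
      simp) x
  rw [Finset.sum_map_toList] at this
  simpa using this

end

section
variable {r : ℕ} (w : Fin r × ℤ → ℝ≥0∞)

/-- displacement of a block of two steps -/
def dd (a : (Fin r × ℤ) × (Fin r × ℤ)) : Fin r → ℤ := ev a.1.1 a.1.2 + ev a.2.1 a.2.2

/-- weight of a block of two steps -/
def ww (w : Fin r × ℤ → ℝ≥0∞) (a : (Fin r × ℤ) × (Fin r × ℤ)) : ℝ≥0∞ := w a.1 * w a.2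

theorem ww_sum (hw : ∑' p, w p = 1) : ∑' a, ww w a = 1 := by
  rw [ENNReal.tsum_prod']
  simp only [ww, ENNReal.tsum_mul_left, hw, mul_one]

theorem EE_Av (T : ℕ) (f : (Fin r → ℤ) → ℝ≥0∞) (h : List ((Fin r × ℤ) × (Fin r × ℤ))) :
    EE (ww w) T (fun h' => f (ps dd h')) h =
      (Av w (fun p => ev p.1 p.2))^[2 * T] f (ps dd h) := by
  induction T generalizing h with
  | zero => rfl
  | succ T ih =>
    simp only [EE, ih]
    rw [mul_add, mul_one, add_comm, Function.iterate_add_apply]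
    simp only [Function.iterate_succ, Function.iterate_zero, Function.comp, id]
    simp only [Av]
    rw [ENNReal.tsum_prod']
    simp only [← ENNReal.tsum_mul_left]
    refine tsum_congr fun a => tsum_congr fun b => ?_
    simp only [ww, ps, dd, add_assoc]
    ring

end

/-! ## Part I: the upper bound, combinatorial form -/

/-- position homomorphism -/
def Lamp.xhom (r : ℕ) : Lamp r →* Multiplicative (Fin r → ℤ) where
  toFun a := Multiplicative.ofAdd a.x
  map_one' := rfl
  map_mul' _ _ := rfl

theorem Lamp.zpow_x {r : ℕ} (a : Lamp r) (m : ℤ) : (a ^ m).x = m • a.x := by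
  have := map_zpow (Lamp.xhom r) a m
  exact congrArg Multiplicative.toAdd this

section
variable {r : ℕ}

theorem gen_zpow_x (i0 i1 i : Fin r) (m : ℤ) : (Lamp.gen i0 i1 i ^ m).x = ev i m := by
  rw [Lamp.zpow_x]
  ext j
  simp [Lamp.gen, ev, Pi.single_apply]

theorem KK_upper (i0 i1 : Fin r) (hne : i0 ≠ i1) (w : Fin r × ℤ → ℝ≥0∞) (hw : ∑' p, w p = 1)
    {G : Type*} [Group G] (s : Fin r → G) (φ : G →* Lamp r) (hφ : ∀ i, φ (s i) = Lamp.gen i0 i1 i)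
    (T k q θ D0 M : ℕ) (hθ : 1 ≤ θ) (hM : θ * D0 ≤ (T + 1) * M)
    (hsp : ∀ H : Finset (Fin r → ℤ), H.card ≤ k → ∀ x,
      (Av w (fun p => ev p.1 p.2))^[2 * T] (fun x => if x ∈ H then 1 else 0) x ≤ 1/4) (g : G) :
    KK w (fun p => s p.1 ^ p.2) (2 * ((T + 1) * (q + 1))) g ≤
      bet θ ^ k + bet 1 ^ D0 + (((T + 1) * (q + 1) + 1 : ℕ) : ℝ≥0∞) ^ k * (T + 1 : ℕ) * 4 ^ M *
        (1 - w (i0, 1) * w (i1, 1)) ^ (q - k) := by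
  set m1 : (Fin r × ℤ) × (Fin r × ℤ) := ((i0, 1), (i1, 1)) with hm1
  set m2 : (Fin r × ℤ) × (Fin r × ℤ) := ((i1, 1), (i0, 1)) with hm2
  have hm12 : m1 ≠ m2 := by
    intro h; rw [hm1, hm2] at h; simp at h; exact hne h.1
  set σ := Equiv.swap m1 m2 with hσ
  have hσ1 : σ m1 = m2 := Equiv.swap_apply_left _ _
  have hσ2 : σ m2 = m1 := Equiv.swap_apply_right _ _
  set V : (Fin r × ℤ) × (Fin r × ℤ) → Lamp r :=
    fun a => Lamp.gen i0 i1 a.1.1 ^ a.1.2 * Lamp.gen i0 i1 a.2.1 ^ a.2.2 with hVd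
  set V' : (Fin r × ℤ) × (Fin r × ℤ) → Lamp r := fun a => V (σ a) with hVd'
  set mk : (Fin r × ℤ) × (Fin r × ℤ) → Prop := fun a => a = m1 ∨ a = m2 with hmk
  have hσn : ∀ a, ¬ mk a → σ a = a := by
    intro a ha
    simp only [hmk, not_or] at ha
    exact Equiv.swap_apply_of_ne_of_ne ha.1 ha.2
  have hwσ : ∀ a, ww w (σ a) = ww w a := by
    intro a
    by_cases ha : mk a
    · rcases ha with rfl | rfl
      · rw [hσ1]; simp [ww, hm1, hm2, mul_comm]
      · rw [hσ2]; simp [ww, hm1, hm2, mul_comm]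
    · rw [hσn a ha]
  have hV : ∀ a, (V a).x = dd a := by
    intro a
    simp [hVd, dd, gen_zpow_x]
  have hdσ : ∀ a, dd (σ a) = dd a := by
    intro a
    by_cases ha : mk a
    · rcases ha with rfl | rfl
      · rw [hσ1]; simp [dd, hm1, hm2, add_comm]
      · rw [hσ2]; simp [dd, hm1, hm2, add_comm]
    · rw [hσn a ha]
  have hV1 : V m1 = Lamp.gen i0 i1 i0 * Lamp.gen i0 i1 i1 := by simp [hVd, hm1]
  have hV2 : V m2 = Lamp.gen i0 i1 i1 * Lamp.gen i0 i1 i0 := by simp [hVd, hm2]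
  set η := ∑' a, ww w a * if mk a then 1 else 0 with hη
  set ηc := ∑' a, ww w a * if mk a then 0 else 1 with hηc
  have hηv : η = 2 * (w (i0, 1) * w (i1, 1)) := by
    rw [hη, tsum_eq_sum (s := {m1, m2})]
    · rw [Finset.sum_pair hm12]
      simp only [hmk, true_or, or_true, if_true, ww, hm1, hm2]
      ring
    · intro a ha
      have : ¬ mk a := by simpa [hmk] using ha
      simp [this]
  have hone : ηc + η = 1 := by
    rw [hη, hηc, ← ENNReal.tsum_add]
    refine Eq.trans ?_ (ww_sum w hw)
    exact tsum_congr fun a => by split_ifs <;> simp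
  have hρ : ηc + η * (1/2) = 1 - w (i0, 1) * w (i1, 1) := by
    have h1 : η * (1/2) = w (i0, 1) * w (i1, 1) := by
      rw [hηv, mul_right_comm, ENNReal.mul_div_cancel (by simp) (by simp), one_mul]
    have h2 : w (i0, 1) * w (i1, 1) ≠ ⊤ := by
      rw [← h1]
      refine ne_top_of_le_ne_top (b := 1) (by simp) ?_
      calc η * (1/2) ≤ 1 * 1 := mul_le_mul' (by rw [← hone]; exact le_add_self) (by simp)
        _ = 1 := one_mul 1
    refine ENNReal.eq_sub_of_add_eq h2 ?_
    rw [h1, add_assoc, ← two_mul, ← hηv, hone]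
  have hKK : KK w (fun p => s p.1 ^ p.2) (2 * ((T + 1) * (q + 1))) g ≤
      KK (ww w) V ((T + 1) * (q + 1)) (φ g) := by
    refine (KK_map w _ φ _ g).trans (le_of_eq ?_)
    rw [KK_two]
    congr 1
    funext a
    simp [hVd, hφ]
  refine hKK.trans ?_
  rw [KK_EE (ww w) V V' (fun F => by
    rw [← Equiv.tsum_eq σ (fun a => ww w a * F (V a))]
    exact tsum_congr fun a => by rw [hwσ]), ← hρ]
  refine EE_upper dd mk (ww w) (ww_sum w hw) T k (fun H hH h => ?_) η ηc (by convert hη) (by convert hηc) V V' hV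
    (fun a => by rw [hVd']; simp only; rw [hV, hdσ]) (fun a ha => by rw [hVd']; simp only; rw [hσn a ha]) ?_
    q θ D0 M hθ hM (φ g)
  · rw [EE_Av w T (fun x => if x ∈ H then 1 else 0)]
    exact hsp H hH _
  · rintro a (rfl | rfl)
    · left
      intro z
      simp only [hVd']
      rw [hσ1, hV1, hV2]
      exact Lamp.gen_diff i0 i1 hne z
    · right
      intro z
      simp only [hVd']
      rw [hσ2, hV1, hV2]
      exact Lamp.gen_diff i0 i1 hne z

end

/-! ## Part J: the upper bound, choice of scales -/

theorem spread_scale {r : ℕ} (α c : Fin r → ℝ) (ab : ℝ) (hab : 0 < ab)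
    (hr : 2 ≤ r) (hα : ∀ i, 0 < α i ∧ α i < 2) (hc : ∀ i, 0 < c i)
    (hnorm : ∀ i, ∑' m : ℤ, c i * (1 + |(m : ℝ)|) ^ (-1 - α i) = 1)
    (hαbar : 1 / ab = (1 / (r : ℝ)) * ∑ i : Fin r, 1 / α i) :
    ∃ c0 : ℝ, 0 < c0 ∧ ∃ R0 : ℝ, ∀ R : ℝ, R0 ≤ R → ∀ t : ℕ, R ≤ t →
      ∀ H : Finset (Fin r → ℤ), (H.card : ℝ) ≤ c0 * R ^ ((r:ℝ)/ab) → ∀ x,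
        (Av (wt α c) (fun p => ev p.1 p.2))^[2 * (r * t)] (fun x => if x ∈ H then 1 else 0) x
          ≤ 1/4 := by
  have hr0 : (0:ℝ) < r := by exact_mod_cast (by omega : 0 < r)
  have : Nonempty (Fin r) := ⟨⟨0, by omega⟩⟩
  have hsum := wt_sum α c hr hc hnorm
  obtain ⟨j0, -, hj0⟩ := Finset.exists_min_image (Finset.univ : Finset (Fin r)) c Finset.univ_nonempty
  set κ : ℝ := c j0 / (4 * r) with hκ
  have hκ0 : 0 < κ := div_pos (hc j0) (by positivity)
  set ε : ℝ := κ / (4 * r) with hε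
  have hε0 : 0 < ε := by positivity
  refine ⟨ε ^ ((r:ℝ)/ab) / 8, by positivity, 1 / ε, fun R hR t ht H hH x => ?_⟩
  have hεR : 1 ≤ ε * R := by
    rw [div_le_iff₀ hε0] at hR; linarith
  have hεR0 : 0 < ε * R := by linarith
  have hR0 : 0 < R := by
    by_contra h; push Not at h; nlinarith
  set X : Fin r → ℝ := fun i => (ε * R) ^ (1 / α i) with hX
  have hX1 : ∀ i, 1 ≤ X i := fun i => Real.one_le_rpow hεR (by have := (hα i).1; positivity)
  set L : Fin r → ℕ := fun i => ⌊X i⌋₊ with hL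
  have hLX : ∀ i, (L i : ℝ) ≤ X i := fun i => Nat.floor_le (by linarith [hX1 i])
  have hXL : ∀ i, X i ≤ 2 * L i + 1 := fun i => by
    have := Nat.lt_floor_add_one (X i)
    have h0 : (0:ℝ) ≤ L i := by positivity
    simp only [hL] at h0 ⊢; linarith
  set b : ℝ := κ / (ε * R) with hb
  have hb0 : 0 < b := by positivity
  have hdom : ∀ i m, (fun _ : Fin r => ENNReal.ofReal b) i * unif (L i) m ≤ wt α c (i, m) := by
    intro i m
    simp only [unif]
    split_ifs with hm
    · rw [Finset.mem_Icc] at hm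
      have hm' : |(m:ℝ)| ≤ L i := by
        rw [abs_le]; constructor
        · exact_mod_cast hm.1
        · exact_mod_cast hm.2
      rw [← ENNReal.ofReal_natCast, ← ENNReal.ofReal_inv_of_pos (by positivity),
        ← ENNReal.ofReal_mul hb0.le, wt]
      apply ENNReal.ofReal_le_ofReal
      have hαi := hα i
      have hL0 : (0:ℝ) ≤ L i := by positivity
      have h1 : (1 + (L i:ℝ)) ^ (-1 - α i) ≤ (1 + |(m:ℝ)|) ^ (-1 - α i) :=
        Real.rpow_le_rpow_of_nonpos (by positivity) (by linarith) (by linarith)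
      have h2 : (1 + (L i:ℝ)) ^ (α i) ≤ 4 * (ε * R) := by
        calc (1 + (L i:ℝ)) ^ (α i) ≤ (2 * X i) ^ (α i) := by
              apply Real.rpow_le_rpow (by positivity) _ hαi.1.le
              linarith [hLX i, hX1 i]
          _ = 2 ^ (α i) * (ε * R) := by
              rw [Real.mul_rpow (by norm_num) (by linarith [hX1 i]), hX]
              simp only
              rw [← Real.rpow_mul hεR0.le, one_div_mul_cancel hαi.1.ne', Real.rpow_one]
          _ ≤ 2 ^ (2:ℝ) * (ε * R) := by
              gcongr
              · norm_num
              · exact hαi.2.le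
          _ = _ := by norm_num
      have h3 : (1 + (L i:ℝ)) ^ (-1 - α i) = (1 + (L i:ℝ))⁻¹ * ((1 + (L i:ℝ)) ^ (α i))⁻¹ := by
        rw [Real.rpow_sub (by positivity), Real.rpow_neg_one, div_eq_mul_inv]
      have h4 : (4 * (ε * R))⁻¹ ≤ ((1 + (L i:ℝ)) ^ (α i))⁻¹ := by
        gcongr
      have h5 : ((2 * L i + 1 : ℕ) : ℝ)⁻¹ ≤ (1 + (L i:ℝ))⁻¹ := by
        push_cast
        gcongr ?_⁻¹
        linarith
      have h6 : c j0 ≤ c i := hj0 i (Finset.mem_univ _)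
      calc b * ((2 * L i + 1 : ℕ) : ℝ)⁻¹ = (1 / r) * (c j0 * (((2 * L i + 1 : ℕ) : ℝ)⁻¹ * (4 * (ε * R))⁻¹)) := by
            rw [hb, hκ]; field_simp
        _ ≤ (1 / r) * (c i * ((1 + (L i:ℝ))⁻¹ * ((1 + (L i:ℝ)) ^ (α i))⁻¹)) := by
            have := (hc i).le
            gcongr
        _ ≤ _ := by
            rw [← h3]
            have := (hc i).le
            gcongr
    · simp
  have hsp := spread (wt α c) hsum L (fun _ => ENNReal.ofReal b) hdom H (2 * t) x
  rw [show 2 * t * r = 2 * (r * t) by ring] at hsp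
  refine hsp.trans ?_
  have h1 : ∑ _i : Fin r, (1 - ENNReal.ofReal b) ^ (2 * t) ≤ ENNReal.ofReal (1/8) := by
    have h2 : (1 - ENNReal.ofReal b) ^ (2 * t) ≤ ENNReal.ofReal (1 / (8 * r)) := by
      rw [← ENNReal.ofReal_one, ← ENNReal.ofReal_sub _ hb0.le]
      calc ENNReal.ofReal (1 - b) ^ (2 * t) ≤ ENNReal.ofReal (Real.exp (-b)) ^ (2 * t) := by
            gcongr
            linarith [Real.add_one_le_exp (-b)]
        _ = ENNReal.ofReal (Real.exp (-b) ^ (2 * t)) := by rw [ENNReal.ofReal_pow (Real.exp_pos _).le]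
        _ ≤ _ := by
            apply ENNReal.ofReal_le_ofReal
            rw [← Real.exp_nat_mul]
            have h3 : 8 * r ≤ ((2 * t : ℕ) : ℝ) * b := by
              push_cast
              calc (8 * r : ℝ) = 2 * R * b := by
                    rw [hb, hε]; field_simp; norm_num
                _ ≤ 2 * t * b := by gcongr
            rw [mul_neg, Real.exp_neg, one_div]
            gcongr
            linarith [Real.add_one_le_exp (((2 * t : ℕ) : ℝ) * b)]
    calc _ ≤ ∑ _i : Fin r, ENNReal.ofReal (1 / (8 * r)) := Finset.sum_le_sum fun _ _ => h2
      _ = ENNReal.ofReal (1/8) := by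
          rw [Finset.sum_const, Finset.card_univ, Fintype.card_fin, nsmul_eq_mul,
            ← ENNReal.ofReal_natCast, ← ENNReal.ofReal_mul (by positivity)]
          congr 1; field_simp
  have h2 : (∏ i, ((2 * L i + 1 : ℕ) : ℝ≥0∞)⁻¹) * H.card ≤ ENNReal.ofReal (1/8) := by
    have h3 : ∏ i, ((2 * L i + 1 : ℕ) : ℝ≥0∞)⁻¹ ≤ ENNReal.ofReal (∏ i, (X i)⁻¹) := by
      rw [ENNReal.ofReal_prod_of_nonneg (fun i _ => inv_nonneg.2 (by linarith [hX1 i]))]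
      refine Finset.prod_le_prod' fun i _ => ?_
      rw [← ENNReal.ofReal_natCast, ← ENNReal.ofReal_inv_of_pos (by positivity)]
      apply ENNReal.ofReal_le_ofReal
      have := hX1 i
      push_cast
      gcongr
      exact hXL i
    refine (mul_le_mul' h3 le_rfl).trans ?_
    rw [← ENNReal.ofReal_natCast, ← ENNReal.ofReal_mul (Finset.prod_nonneg fun i _ => inv_nonneg.2 (by linarith [hX1 i]))]
    apply ENNReal.ofReal_le_ofReal
    rw [Finset.prod_inv_distrib, prod_R r ab hab α hr hαbar _ hεR0, Real.mul_rpow hε0.le hR0.le]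
    have hp1 : 0 < ε ^ ((r:ℝ)/ab) := by positivity
    have hp2 : 0 < R ^ ((r:ℝ)/ab) := by positivity
    rw [inv_mul_le_iff₀ (by positivity)]
    calc (H.card : ℝ) ≤ _ := hH
      _ = _ := by ring
  calc _ ≤ ENNReal.ofReal (1/8) + ENNReal.ofReal (1/8) := add_le_add h1 h2
    _ = ENNReal.ofReal (1/4) := by rw [← ENNReal.ofReal_add (by norm_num) (by norm_num)]; norm_num
    _ ≤ 1/4 := by
      rw [ENNReal.ofReal_div_of_pos (by norm_num)]; simp

theorem bet_pow (θ k : ℕ) : bet θ ^ k = ENNReal.ofReal (Real.exp (-(Real.log (1 + θ) / 2 * k))) := by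
  rw [bet, ← ENNReal.ofReal_pow (by positivity)]
  congr 1
  have h : Real.sqrt (1 + θ) = Real.exp (Real.log (1 + θ) / 2) := by
    rw [Real.sqrt_eq_rpow, Real.rpow_def_of_pos (by positivity)]
    congr 1; ring
  rw [h, one_div, ← Real.exp_neg, ← Real.exp_nat_mul]
  congr 1; ring

theorem log_RR (r : ℕ) (ab : ℝ) (hab : 0 < ab) {n : ℕ} (hn : 3 ≤ n) :
    ab / (r + ab) * (Real.log n / 2) ≤ Real.log (RR r ab n) := by
  have hl := log_ge_one hn
  have hn0 : (0:ℝ) < n := by positivity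
  rw [RR, Real.log_rpow (by positivity), Real.log_div (by positivity) (by positivity)]
  gcongr
  have h1 : Real.log (Real.log n) = Real.log (Real.log n / 2) + Real.log 2 := by
    rw [← Real.log_mul (by positivity) (by norm_num)]; congr 1; ring
  have h2 := Real.log_le_sub_one_of_pos (x := Real.log n / 2) (by positivity)
  have h3 := Real.log_two_lt_d9
  linarith

set_option maxHeartbeats 4000000 in
theorem upper_final {r : ℕ} (α c : Fin r → ℝ) (ab : ℝ) (hab : 0 < ab)
    (hr : 2 ≤ r) (hα : ∀ i, 0 < α i ∧ α i < 2) (hc : ∀ i, 0 < c i)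
    (hnorm : ∀ i, ∑' m : ℤ, c i * (1 + |(m : ℝ)|) ^ (-1 - α i) = 1)
    (hαbar : 1 / ab = (1 / (r : ℝ)) * ∑ i : Fin r, 1 / α i) (i0 i1 : Fin r) (hne : i0 ≠ i1)
    {G : Type*} [Group G] (s : Fin r → G) (φ : G →* Lamp r) (hφ : ∀ i, φ (s i) = Lamp.gen i0 i1 i) :
    ∃ C : ℝ, 1 ≤ C ∧ ∃ n₀ : ℕ, ∀ n : ℕ, n₀ ≤ n →
      (KK (wt α c) (fun p => s p.1 ^ p.2) n 1).toReal ≤ Real.exp (-(1 / C) * QQ r ab n) := by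
  have hr0 : (0:ℝ) < r := by exact_mod_cast (by omega : 0 < r)
  have hr2 : (2:ℝ) ≤ r := by exact_mod_cast hr
  have hsum := wt_sum α c hr hc hnorm
  obtain ⟨c0, hc0, R0, hspr⟩ := spread_scale α c ab hab hr hα hc hnorm hαbar
  obtain ⟨p, hp0, hp⟩ : ∃ p : ℝ, 0 < p ∧ wt α c (i0, 1) * wt α c (i1, 1) = ENNReal.ofReal p := by
    have h0 := hc i0
    have h1 := hc i1
    refine ⟨_, ?_, (ENNReal.ofReal_mul ?_).symm⟩ <;> positivity
  set lam : ℝ := p / (6 * r) with hlam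
  have hlam0 : 0 < lam := by positivity
  set c1 : ℝ := min c0 (lam / (4 * (1 + p))) with hc1
  have hc10 : 0 < c1 := lt_min hc0 (by positivity)
  have hc1c0 : c1 ≤ c0 := min_le_left _ _
  have hc1p : c1 * (1 + p) ≤ lam / 4 := by
    calc c1 * (1 + p) ≤ (lam / (4 * (1 + p))) * (1 + p) := by gcongr; exact min_le_right _ _
      _ = lam / 4 := by field_simp
  set s' : ℝ := ab / (r + ab) with hs'
  have hs'0 : 0 < s' := by positivity
  set δ : ℝ := min (c1 * s' / 16) (min (1 / 4) (lam / 4)) with hδ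
  have hδ0 : 0 < δ := lt_min (by positivity) (lt_min (by norm_num) (by positivity))
  have hd1 : δ ≤ c1 * s' / 16 := min_le_left _ _
  have hd2 : δ ≤ 1 / 4 := (min_le_right _ _).trans (min_le_left _ _)
  have hd3 : δ ≤ lam / 4 := (min_le_right _ _).trans (min_le_right _ _)
  refine ⟨max 1 (2 / δ), le_max_left _ _, ?_⟩
  have hRt := RR_tendsto r ab hab
  have hVt := VV_tendsto r ab hab hr
  have hQt := QQ_tendsto r ab hab hr
  have hev := (Filter.eventually_ge_atTop 3).and <| (hRt.eventually_ge_atTop R0).and <|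
    (hRt.eventually_ge_atTop 1).and <| (hRt.eventually_ge_atTop ((64 / lam) ^ 2)).and <|
    (hVt.eventually_ge_atTop (8 / lam)).and <| (hVt.eventually_ge_atTop (2 / c1)).and <|
    (hQt.eventually_ge_atTop ((8 + 8 * p) / lam)).and <| (hQt.eventually_ge_atTop (4 / δ)).and <|
    (hQt.eventually_ge_atTop 1).and <| hQt.eventually_ge_atTop (6 * r)
  obtain ⟨n₀, hn₀⟩ := Filter.eventually_atTop.1 hev
  refine ⟨n₀, fun n hn => ?_⟩
  obtain ⟨hn3, hRR0, hR1, hR64, hV8, hVc, hQp, hQδ, hQ1, hQr⟩ := hn₀ n hn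
  set R := RR r ab n with hR
  set V := VV r ab n with hV
  set Q := QQ r ab n with hQ
  set l := Real.log n with hl
  have hl1 : 1 ≤ l := log_ge_one hn3
  have hn0 : (0:ℝ) < n := by positivity
  have hVl : V * l = Q := rate_V r ab hab hn3
  have hRn : (n:ℝ) = Q * R := by
    have := rate_R r ab hab hn3
    rw [← hR, ← hQ, div_eq_iff (by linarith)] at this; exact this
  have hRV : R ^ ((r:ℝ)/ab) = V := rate_RV r ab hab hn3
  have hlogR : s' * (l / 2) ≤ Real.log R := log_RR r ab hab hn3
  have hV0 : 0 < V := lt_of_lt_of_le (by positivity) hV8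
  have hR0' : 0 < R := by linarith
  have hVQ : V ≤ Q := by rw [← hVl]; nlinarith
  set t := ⌈R⌉₊ with ht
  have hRt' : R ≤ t := Nat.le_ceil R
  have htR : (t:ℝ) ≤ R + 1 := (Nat.ceil_lt_add_one hR0'.le).le
  set T := r * t with hT
  have hTle : ((T + 1 : ℕ) : ℝ) ≤ 3 * r * R := by
    push_cast
    rw [hT]; push_cast
    nlinarith
  have hTge : R ≤ ((T + 1 : ℕ) : ℝ) := by
    push_cast
    rw [hT]; push_cast
    nlinarith
  set k := ⌊c1 * V⌋₊ with hk
  have hkle : (k:ℝ) ≤ c1 * V := Nat.floor_le (by positivity)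
  have hkge : c1 * V / 2 ≤ k := by
    have h1 := Nat.lt_floor_add_one (c1 * V)
    have h2 : 2 ≤ c1 * V := by rw [div_le_iff₀ hc10] at hVc; linarith
    simp only [hk]; linarith
  set q1 := n / (2 * (T + 1)) with hq1
  have hq1pos : 1 ≤ q1 := by
    rw [hq1, Nat.one_le_div_iff (by omega)]
    have : ((2 * (T + 1) : ℕ) : ℝ) ≤ n := by
      calc ((2 * (T + 1) : ℕ) : ℝ) = 2 * ((T + 1 : ℕ) : ℝ) := by push_cast; ring
        _ ≤ 2 * (3 * r * R) := by gcongr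
        _ = (6 * r) * R := by ring
        _ ≤ Q * R := by gcongr
        _ = n := hRn.symm
    exact_mod_cast this
  obtain ⟨q, hq⟩ : ∃ q, q1 = q + 1 := ⟨q1 - 1, by omega⟩
  have hN : 2 * ((T + 1) * (q + 1)) ≤ n := by
    rw [← hq, ← mul_assoc]; exact Nat.mul_div_le n _
  have hN1 : (T + 1) * (q + 1) + 1 ≤ n := by
    have : 1 ≤ (T + 1) * (q + 1) := Nat.one_le_iff_ne_zero.2 (by positivity)
    omega
  have hqge : Q / (6 * r) - 2 ≤ q := by
    have h1 : n < (2 * (T + 1)) * (q1 + 1) := Nat.lt_mul_div_succ n (by omega)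
    have h2 : (n:ℝ) < (2 * ((T + 1 : ℕ) : ℝ)) * ((q:ℝ) + 2) := by
      have : (n:ℝ) < (((2 * (T + 1)) * (q1 + 1) : ℕ) : ℝ) := by exact_mod_cast h1
      rw [hq] at this; push_cast at this ⊢; linarith
    have h3 : Q * R < 6 * r * R * (q + 2) := by
      rw [← hRn]
      calc (n:ℝ) < _ := h2
        _ ≤ (2 * (3 * r * R)) * ((q:ℝ) + 2) := by gcongr
        _ = _ := by ring
    have h4 : Q < 6 * r * (q + 2) := by
      by_contra h; push Not at h
      nlinarith
    rw [sub_le_iff_le_add, div_le_iff₀ (by positivity)]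
    linarith
  set θ := ⌈Real.sqrt R⌉₊ with hθ
  have hsR1 : 1 ≤ Real.sqrt R := Real.one_le_sqrt.2 hR1
  have hθge : Real.sqrt R ≤ θ := Nat.le_ceil _
  have hθle : (θ:ℝ) ≤ 2 * Real.sqrt R := by
    have := (Nat.ceil_lt_add_one (Real.sqrt_nonneg R)).le
    simp only [hθ]; linarith
  have hθ1 : 1 ≤ θ := by exact_mod_cast hsR1.trans hθge
  set D0 := ⌈Q⌉₊ with hD0
  have hD0ge : Q ≤ D0 := Nat.le_ceil _
  have hD0le : (D0:ℝ) ≤ 2 * Q := by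
    have := (Nat.ceil_lt_add_one (by linarith : 0 ≤ Q)).le
    simp only [hD0]; linarith
  set M := θ * D0 / (T + 1) + 1 with hM
  have hMge : θ * D0 ≤ (T + 1) * M := (Nat.lt_mul_div_succ _ (by omega)).le
  have hsq : Real.sqrt R * Real.sqrt R = R := Real.mul_self_sqrt hR0'.le
  have hs64 : 64 / lam ≤ Real.sqrt R := Real.le_sqrt_of_sq_le hR64
  have hMle : (M:ℝ) ≤ lam / 16 * Q + 1 := by
    have h1 : (((θ * D0 / (T + 1) : ℕ)) : ℝ) ≤ lam / 16 * Q := by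
      refine (Nat.cast_div_le).trans ?_
      rw [div_le_iff₀ (by positivity)]
      push_cast
      have h2 : 64 ≤ lam * Real.sqrt R := by rw [div_le_iff₀ hlam0] at hs64; linarith
      calc (θ:ℝ) * D0 ≤ (2 * Real.sqrt R) * (2 * Q) := by gcongr
        _ = 64 * (Real.sqrt R * Q / 16) := by ring
        _ ≤ (lam * Real.sqrt R) * (Real.sqrt R * Q / 16) := by gcongr
        _ = lam / 16 * Q * (Real.sqrt R * Real.sqrt R) := by ring
        _ ≤ lam / 16 * Q * ((T:ℝ) + 1) := by
            rw [hsq]; gcongr; exact_mod_cast hTge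
    simp only [hM]; push_cast; linarith
  have hmain := KK_upper i0 i1 hne (wt α c) hsum s φ hφ T k q θ D0 M hθ1 hMge (by
    intro H hH x
    refine hspr R hRR0 t hRt' H ?_ x
    rw [hRV]
    calc (H.card : ℝ) ≤ k := by exact_mod_cast hH
      _ ≤ c1 * V := hkle
      _ ≤ c0 * V := by gcongr)
  -- the three terms
  have hA : bet θ ^ k ≤ ENNReal.ofReal (Real.exp (-(δ * Q))) := by
    rw [bet_pow]
    apply ENNReal.ofReal_le_ofReal
    apply Real.exp_le_exp.2
    have h1 : Real.log R / 2 ≤ Real.log (1 + θ) := by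
      rw [← Real.log_sqrt hR0'.le]
      exact Real.log_le_log (by positivity) (by linarith)
    have h2 : s' * l / 8 ≤ Real.log (1 + θ) / 2 := by linarith
    have h3 : (s' * l / 8) * (c1 * V / 2) ≤ Real.log (1 + θ) / 2 * k := by
      apply mul_le_mul h2 hkge (by positivity)
      exact le_trans (by positivity) h2
    have h4 : (s' * l / 8) * (c1 * V / 2) = c1 * s' / 16 * Q := by rw [← hVl]; ring
    have h5 : δ * Q ≤ c1 * s' / 16 * Q := by gcongr
    linarith
  have hB : bet 1 ^ D0 ≤ ENNReal.ofReal (Real.exp (-(δ * Q))) := by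
    rw [bet_pow]
    apply ENNReal.ofReal_le_ofReal
    apply Real.exp_le_exp.2
    have h1 : (1:ℝ)/4 ≤ Real.log (1 + (1:ℕ)) / 2 := by
      have := Real.log_two_gt_d9
      push_cast
      rw [one_add_one_eq_two]; linarith
    have h2 : δ * Q ≤ Real.log (1 + (1:ℕ)) / 2 * D0 := by
      apply mul_le_mul (hd2.trans h1) hD0ge (by linarith)
      linarith
    linarith
  have hC : (((T + 1) * (q + 1) + 1 : ℕ) : ℝ≥0∞) ^ k * (T + 1 : ℕ) * 4 ^ M *
        (1 - wt α c (i0, 1) * wt α c (i1, 1)) ^ (q - k) ≤ ENNReal.ofReal (Real.exp (-(δ * Q))) := by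
    have e1 : (((T + 1) * (q + 1) + 1 : ℕ) : ℝ≥0∞) ≤ ENNReal.ofReal (Real.exp l) := by
      rw [hl, Real.exp_log hn0, ENNReal.ofReal_natCast]
      exact_mod_cast hN1
    have e2 : ((T + 1 : ℕ) : ℝ≥0∞) ≤ ENNReal.ofReal (Real.exp l) := by
      rw [hl, Real.exp_log hn0, ENNReal.ofReal_natCast]
      have : T + 1 ≤ n := by nlinarith
      exact_mod_cast this
    have e3 : (4:ℝ≥0∞) ≤ ENNReal.ofReal (Real.exp 2) := by
      have h1 : (4:ℝ) ≤ Real.exp 2 := by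
        have := Real.exp_one_gt_d9
        rw [show (2:ℝ) = 1 + 1 by norm_num, Real.exp_add]; nlinarith
      calc (4:ℝ≥0∞) = ENNReal.ofReal 4 := by simp
        _ ≤ _ := ENNReal.ofReal_le_ofReal h1
    have e4 : 1 - wt α c (i0, 1) * wt α c (i1, 1) ≤ ENNReal.ofReal (Real.exp (-p)) := by
      rw [hp, ← ENNReal.ofReal_one, ← ENNReal.ofReal_sub _ hp0.le]
      apply ENNReal.ofReal_le_ofReal
      linarith [Real.add_one_le_exp (-p)]
    calc _ ≤ ENNReal.ofReal (Real.exp l) ^ k * ENNReal.ofReal (Real.exp l) *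
          ENNReal.ofReal (Real.exp 2) ^ M * ENNReal.ofReal (Real.exp (-p)) ^ (q - k) := by
            gcongr
      _ = ENNReal.ofReal (Real.exp (k * l + l + M * 2 + ((q - k : ℕ) : ℝ) * (-p))) := by
          rw [← ENNReal.ofReal_pow (Real.exp_pos _).le, ← ENNReal.ofReal_pow (Real.exp_pos _).le,
            ← ENNReal.ofReal_pow (Real.exp_pos _).le, ← ENNReal.ofReal_mul (by positivity),
            ← ENNReal.ofReal_mul (by positivity), ← ENNReal.ofReal_mul (by positivity)]
          rw [Real.exp_add, Real.exp_add, Real.exp_add, Real.exp_nat_mul, Real.exp_nat_mul,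
            Real.exp_nat_mul]
      _ ≤ _ := by
          apply ENNReal.ofReal_le_ofReal
          apply Real.exp_le_exp.2
          have f1 : (k:ℝ) * l ≤ c1 * Q := by
            rw [← hVl, ← mul_assoc]; gcongr
          have f2 : l ≤ lam / 8 * Q := by
            have : 1 ≤ lam / 8 * V := by
              rw [div_le_iff₀ hlam0] at hV8; linarith
            rw [← hVl, ← mul_assoc]; nlinarith
          have f3 : (q:ℝ) - k ≤ ((q - k : ℕ) : ℝ) := by
            have : q ≤ (q - k) + k := by omega
            have : (q:ℝ) ≤ ((q - k : ℕ) : ℝ) + k := by exact_mod_cast this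
            linarith
          have f4 : (k:ℝ) ≤ c1 * Q := hkle.trans (by gcongr)
          have f5 : ((q - k : ℕ) : ℝ) * (-p) ≤ -(lam * Q) + 2 * p + p * (c1 * Q) := by
            have h1 : Q / (6 * r) - 2 - c1 * Q ≤ ((q - k : ℕ) : ℝ) := by linarith
            have h2 := mul_le_mul_of_nonneg_left h1 hp0.le
            have h3 : p * (Q / (6 * r) - 2 - c1 * Q) = lam * Q - 2 * p - p * (c1 * Q) := by
              rw [hlam]; ring
            linarith
          have f6 : (8 + 8 * p) ≤ lam * Q := by
            rw [div_le_iff₀ hlam0] at hQp; linarith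
          have f7 : c1 * (1 + p) * Q ≤ lam / 4 * Q := by gcongr
          have f8 : δ * Q ≤ lam / 4 * Q := by gcongr
          nlinarith
  have hall : KK (wt α c) (fun p => s p.1 ^ p.2) n 1 ≤ ENNReal.ofReal (3 * Real.exp (-(δ * Q))) := by
    have h1 := KK_sup (wt α c) (fun p => s p.1 ^ p.2) hsum (2 * ((T + 1) * (q + 1))) _ hmain
      (n - 2 * ((T + 1) * (q + 1))) 1
    rw [Nat.add_sub_cancel' hN] at h1
    refine h1.trans ((add_le_add (add_le_add hA hB) hC).trans (le_of_eq ?_))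
    rw [← ENNReal.ofReal_add (by positivity) (by positivity),
      ← ENNReal.ofReal_add (by positivity) (by positivity)]
    congr 1; ring
  have h2 := ENNReal.toReal_mono ENNReal.ofReal_ne_top hall
  rw [ENNReal.toReal_ofReal (by positivity)] at h2
  refine h2.trans ?_
  have h3 : (3:ℝ) ≤ Real.exp (δ / 2 * Q) := by
    have h4 : 2 ≤ δ / 2 * Q := by
      rw [div_le_iff₀ hδ0] at hQδ; linarith
    linarith [Real.add_one_le_exp (δ / 2 * Q)]
  calc 3 * Real.exp (-(δ * Q)) ≤ Real.exp (δ / 2 * Q) * Real.exp (-(δ * Q)) := by gcongr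
    _ = Real.exp (-(δ / 2) * Q) := by rw [← Real.exp_add]; congr 1; ring
    _ ≤ _ := by
        apply Real.exp_le_exp.2
        have h5 : 1 / max 1 (2 / δ) ≤ δ / 2 := by
          rw [div_le_iff₀ (by positivity)]
          calc (1:ℝ) = δ / 2 * (2 / δ) := by field_simp
            _ ≤ _ := by gcongr; exact le_max_right _ _
        gcongr

theorem hcom_metab {F : Type*} [Group F] (a b : commutator (F ⧸ derivedSeries F 2)) :
    a * b = b * a := by
  have hD : derivedSeries (F ⧸ derivedSeries F 2) 2 = ⊥ := by
    rw [eq_bot_iff, ← map_derivedSeries_eq (f := QuotientGroup.mk' (derivedSeries F 2))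
      (QuotientGroup.mk'_surjective _)]
    rintro _ ⟨x, hx, rfl⟩
    rw [Subgroup.mem_bot]
    exact (QuotientGroup.eq_one_iff x).2 hx
  apply Subtype.ext
  have ha : (a : F ⧸ derivedSeries F 2) ∈ derivedSeries (F ⧸ derivedSeries F 2) 1 := by
    rw [derivedSeries_one]; exact a.2
  have hb : (b : F ⧸ derivedSeries F 2) ∈ derivedSeries (F ⧸ derivedSeries F 2) 1 := by
    rw [derivedSeries_one]; exact b.2
  have h := Subgroup.commutator_mem_commutator ha hb
  rw [← derivedSeries_succ, hD, Subgroup.mem_bot, commutatorElement_eq_one_iff_mul_comm] at h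
  exact h

theorem mu_conv {r : ℕ} (α c : Fin r → ℝ) (hc : ∀ i, 0 < c i)
    (hnorm : ∀ i, ∑' m : ℤ, c i * (1 + |(m : ℝ)|) ^ (-1 - α i) = 1)
    {G : Type*} [Group G] (s : Fin r → G) (g : G) :
    (1 / (r : ℝ)) * ∑ i : Fin r, ∑' m : ℤ,
      (if g = s i ^ m then c i * (1 + |(m : ℝ)|) ^ (-1 - α i) else 0) =
    (∑' p : Fin r × ℤ, if g = s p.1 ^ p.2 then wt α c p else 0).toReal := by
  have hnn : ∀ i (m : ℤ), 0 ≤ (if g = s i ^ m then c i * (1 + |(m : ℝ)|) ^ (-1 - α i) else 0) := by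
    intro i m
    have := hc i
    split_ifs <;> positivity
  have hsm : ∀ i, Summable fun m : ℤ =>
      (if g = s i ^ m then c i * (1 + |(m : ℝ)|) ^ (-1 - α i) else 0) := by
    intro i
    refine Summable.of_nonneg_of_le (hnn i) ?_ (wt_summable α c hnorm i)
    intro m
    have := hc i
    split_ifs
    · exact le_rfl
    · positivity
  have h : ∀ i : Fin r, (∑' m : ℤ, if g = s i ^ m then wt α c (i, m) else 0) =
      ENNReal.ofReal ((1 / (r:ℝ)) * ∑' m : ℤ,
        (if g = s i ^ m then c i * (1 + |(m : ℝ)|) ^ (-1 - α i) else 0)) := by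
    intro i
    rw [← tsum_mul_left, ENNReal.ofReal_tsum_of_nonneg _ ((hsm i).mul_left _)]
    · refine tsum_congr fun m => ?_
      split_ifs
      · rfl
      · simp
    · intro m; exact mul_nonneg (by positivity) (hnn i m)
  rw [ENNReal.tsum_prod', tsum_fintype]
  simp only [h]
  rw [← ENNReal.ofReal_sum_of_nonneg, ENNReal.toReal_ofReal, Finset.mul_sum]
  · exact Finset.sum_nonneg fun i _ => mul_nonneg (by positivity) (tsum_nonneg (hnn i))
  · exact fun i _ => mul_nonneg (by positivity) (tsum_nonneg (hnn i))

/-- Theorem: on the free metabelian group `S_{2,r}` (`r ≥ 2`), the random walk driven by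
`μ_a(g) = (1/r) Σᵢ Σ_m cᵢ (1+|m|)^{-1-αᵢ} 1{g = sᵢ^m}` (with `αᵢ ∈ (0,2)`) satisfies
`μ_a^{(n)}(e) ≍ exp(− n^{r/(r+α)} (log n)^{α/(r+α)})` with `1/α = (1/r) Σᵢ 1/αᵢ`. -/
theorem return_probability_free_metabelian_heavy_tails (r : ℕ) (hr : 2 ≤ r)
    (α : Fin r → ℝ) (hα : ∀ i, 0 < α i ∧ α i < 2)
    (c : Fin r → ℝ) (hc : ∀ i, 0 < c i)
    (hnorm : ∀ i, ∑' m : ℤ, c i * (1 + |(m : ℝ)|) ^ (-1 - α i) = 1)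
    (αbar : ℝ) (hαbar : 1 / αbar = (1 / (r : ℝ)) * ∑ i : Fin r, 1 / α i)
    (μ : (FreeGroup (Fin r) ⧸ derivedSeries (FreeGroup (Fin r)) 2) → ℝ)
    (hμ : ∀ g, μ g = (1 / (r : ℝ)) * ∑ i : Fin r, ∑' m : ℤ,
      if g = (QuotientGroup.mk (FreeGroup.of i) :
          FreeGroup (Fin r) ⧸ derivedSeries (FreeGroup (Fin r)) 2) ^ m
      then c i * (1 + |(m : ℝ)|) ^ (-1 - α i) else 0) :
    ∃ C : ℝ, 1 ≤ C ∧ ∃ n₀ : ℕ, ∀ n : ℕ, n₀ ≤ n →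
      Real.exp (-C * (n : ℝ) ^ ((r : ℝ) / ((r : ℝ) + αbar)) *
          (Real.log n) ^ (αbar / ((r : ℝ) + αbar)))
        ≤ convPow μ n 1 ∧
      convPow μ n 1
        ≤ Real.exp (-(1 / C) * (n : ℝ) ^ ((r : ℝ) / ((r : ℝ) + αbar)) *
          (Real.log n) ^ (αbar / ((r : ℝ) + αbar))) := by
  have hr0 : (0:ℝ) < r := by exact_mod_cast (by omega : 0 < r)
  have hab : 0 < αbar := by
    have h1 : 0 < 1 / αbar := by
      rw [hαbar]
      apply mul_pos (by positivity)
      refine Finset.sum_pos (fun i _ => one_div_pos.2 (hα i).1) ⟨⟨0, by omega⟩, Finset.mem_univ _⟩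
    exact one_div_pos.1 h1
  set s : Fin r → FreeGroup (Fin r) ⧸ derivedSeries (FreeGroup (Fin r)) 2 :=
    fun i => QuotientGroup.mk (FreeGroup.of i) with hs
  let i0 : Fin r := ⟨0, by omega⟩
  let i1 : Fin r := ⟨1, by omega⟩
  have hne : i0 ≠ i1 := by simp [i0, i1]
  have hker : ∀ x ∈ derivedSeries (FreeGroup (Fin r)) 2,
      FreeGroup.lift (Lamp.gen i0 i1) x = 1 := by
    intro x hx
    have h := map_derivedSeries_le_derivedSeries (FreeGroup.lift (Lamp.gen i0 i1)) 2
      (Subgroup.mem_map_of_mem _ hx)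
    rw [Lamp.derived_two, Subgroup.mem_bot] at h
    exact h
  let φ : FreeGroup (Fin r) ⧸ derivedSeries (FreeGroup (Fin r)) 2 →* Lamp r :=
    QuotientGroup.lift _ (FreeGroup.lift (Lamp.gen i0 i1)) hker
  have hφ : ∀ i, φ (s i) = Lamp.gen i0 i1 i := fun i => by
    have : φ (s i) = FreeGroup.lift (Lamp.gen i0 i1) (FreeGroup.of i) := rfl
    rw [this, FreeGroup.lift_apply_of]
  obtain ⟨C1, hC1, n1, h1⟩ := lower_final α c αbar hab hr hα hc hnorm hαbar s hcom_metab
  obtain ⟨C2, hC2, n2, h2⟩ := upper_final α c αbar hab hr hα hc hnorm hαbar i0 i1 hne s φ hφ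
  have hconv : ∀ n, convPow μ n 1 = (KK (wt α c) (fun p => s p.1 ^ p.2) n 1).toReal := by
    intro n
    refine KK_convPow (wt α c) (fun p => s p.1 ^ p.2) (wt_sum α c hr hc hnorm) μ (fun g => ?_) n 1
    rw [hμ, ← mu_conv α c hc hnorm s g]
    refine congrArg _ (Finset.sum_congr rfl fun i _ => tsum_congr fun m => ?_)
    congr
  have hQ0 : ∀ n : ℕ, 0 ≤ QQ r αbar n := by
    intro n
    have := Real.log_natCast_nonneg n
    unfold QQ
    positivity
  refine ⟨max C1 C2, hC1.trans (le_max_left _ _), max n1 n2, fun n hn => ?_⟩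
  have hQ : ∀ x : ℝ, x * (n : ℝ) ^ ((r : ℝ) / ((r : ℝ) + αbar)) *
      (Real.log n) ^ (αbar / ((r : ℝ) + αbar)) = x * QQ r αbar n := by
    intro x; unfold QQ; ring
  have hmax : 0 < max C1 C2 := by positivity
  rw [hQ, hQ, hconv]
  constructor
  · refine le_trans (Real.exp_le_exp.2 ?_) (h1 n (le_trans (le_max_left _ _) hn))
    exact mul_le_mul_of_nonneg_right (neg_le_neg (le_max_left _ _)) (hQ0 n)
  · refine (h2 n (le_trans (le_max_right _ _) hn)).trans (Real.exp_le_exp.2 ?_)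
    refine mul_le_mul_of_nonneg_right (neg_le_neg ?_) (hQ0 n)
    exact one_div_le_one_div_of_le (by linarith) (le_max_right _ _)

end
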